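/- arXiv:2110.12026 — 3 statements merged into one kernel-verified Lean document; each statement's English description precedes it below -/
import Mathlib

section
/- Let T > 0 and let u₁, u₂ : ℝ × (0,T] → ℝ be two smooth solutions of the curve shortening flow equation ∂ₜu = uₓₓ/(1 + uₓ²) on ℝ × (0,T]. Suppose there is a Lipschitz continuous function u₀ : ℝ → ℝ such that u₁(·,t) → u₀ and u₂(·,t) → u₀ locally uniformly on ℝ as t → 0⁺. Then u₁ = u₂ on ℝ × (0,T]. -/
open Real Filter Set

noncomputable section

/-- `u : ℝ × S → ℝ` (curried, space then time) solves the curve shortening flow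
equation `∂ₜ u = ∂ₓₓ u / (1 + (∂ₓ u)²)` on the time set `S`. -/
def IsCSFSolution (u : ℝ → ℝ → ℝ) (S : Set ℝ) : Prop :=
  ∀ x : ℝ, ∀ t ∈ S,
    deriv (fun s => u x s) t =
      deriv (deriv (fun y => u y t)) x / (1 + (deriv (fun y => u y t) x) ^ 2)

/-- A smooth convex function, quadratic near `0` and of linear growth at infinity. -/
def softAbs (w : ℝ) : ℝ := √(1 + w ^ 2) - 1

/-- The cutoff `1 - x² / R²`, vanishing at `±R`. -/
def cutoff (R x : ℝ) : ℝ := 1 - x ^ 2 / R ^ 2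

lemma one_le_sqrt_one_add_sq (w : ℝ) : 1 ≤ √(1 + w ^ 2) :=
  Real.one_le_sqrt.2 (by nlinarith [sq_nonneg w])

lemma softAbs_nonneg (w : ℝ) : 0 ≤ softAbs w :=
  sub_nonneg.2 (one_le_sqrt_one_add_sq w)

lemma softAbs_pos {w : ℝ} (hw : w ≠ 0) : 0 < softAbs w := by
  have h : 0 < w ^ 2 := by positivity
  exact sub_pos.2 (Real.lt_sqrt_of_sq_lt (by linarith))

lemma softAbs_le_abs (w : ℝ) : softAbs w ≤ |w| := by
  have h : √(1 + w ^ 2) ≤ 1 + |w| :=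
    Real.sqrt_le_iff.2 ⟨by positivity, by nlinarith [sq_abs w, abs_nonneg w]⟩
  unfold softAbs
  linarith

lemma contDiff_softAbs {n : WithTop ℕ∞} : ContDiff ℝ n softAbs := by
  unfold softAbs
  exact ((contDiff_const.add (contDiff_id.pow 2)).sqrt
    (fun w => (by positivity : (1 : ℝ) + w ^ 2 ≠ 0))).sub contDiff_const

lemma continuous_softAbs : Continuous softAbs := (contDiff_softAbs (n := 0)).continuous

lemma hasDerivAt_sqrt_one_add_sq (w : ℝ) :
    HasDerivAt (fun w : ℝ => √(1 + w ^ 2)) (w / √(1 + w ^ 2)) w := by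
  refine (((hasDerivAt_pow 2 w).const_add 1).sqrt (by positivity)).congr_deriv ?_
  push_cast
  field_simp

lemma hasDerivAt_softAbs (w : ℝ) : HasDerivAt softAbs (w / √(1 + w ^ 2)) w :=
  (hasDerivAt_sqrt_one_add_sq w).sub_const 1

lemma hasDerivAt_deriv_softAbs (w : ℝ) :
    HasDerivAt (fun w : ℝ => w / √(1 + w ^ 2)) (1 / √(1 + w ^ 2) ^ 3) w := by
  have hpos : 0 < √(1 + w ^ 2) := by positivity
  have hsq : √(1 + w ^ 2) ^ 2 = 1 + w ^ 2 := Real.sq_sqrt (by positivity)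
  refine ((hasDerivAt_id' w).div (hasDerivAt_sqrt_one_add_sq w) hpos.ne').congr_deriv ?_
  field_simp
  rw [hsq]
  ring

lemma hasDerivAt_cutoff (R x : ℝ) : HasDerivAt (cutoff R) (-(2 * x / R ^ 2)) x := by
  refine (((hasDerivAt_pow 2 x).div_const (R ^ 2)).const_sub 1).congr_deriv ?_
  push_cast
  ring

lemma continuous_cutoff (R : ℝ) : Continuous (cutoff R) := by
  unfold cutoff
  fun_prop

lemma cutoff_mem_Icc {R x : ℝ} (hR : 0 < R) (hx : x ∈ Icc (-R) R) :
    cutoff R x ∈ Icc (0 : ℝ) 1 := by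
  have h : x ^ 2 ≤ R ^ 2 := sq_le_sq' hx.1 hx.2
  have h' : x ^ 2 / R ^ 2 ≤ 1 := (div_le_one (by positivity)).2 h
  have h'' : 0 ≤ x ^ 2 / R ^ 2 := by positivity
  unfold cutoff
  constructor <;> linarith

lemma cutoff_mono {r R : ℝ} (hr : 0 < r) (hrR : r ≤ R) (x : ℝ) : cutoff r x ≤ cutoff R x := by
  unfold cutoff
  gcongr

lemma sq_arctan_sub_le (a b : ℝ) :
    (arctan a - arctan b) ^ 2 ≤ (a - b) * (arctan a - arctan b) := by
  have hmono : Monotone (fun x : ℝ => x - arctan x) := by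
    refine monotone_of_hasDerivAt_nonneg (f' := fun x => 1 - 1 / (1 + x ^ 2))
      (fun x => (hasDerivAt_id x).sub (hasDerivAt_arctan x)) (fun x => ?_)
    have : 1 / (1 + x ^ 2) ≤ 1 := (div_le_one (by positivity)).2 (by nlinarith [sq_nonneg x])
    simpa using this
  rcases le_total a b with h | h
  · have h1 := hmono h
    have h2 := arctan_strictMono.monotone h
    simp only at h1
    nlinarith
  · have h1 := hmono h
    have h2 := arctan_strictMono.monotone h
    simp only at h1
    nlinarith

lemma abs_arctan_sub_le (a b : ℝ) : |arctan a - arctan b| ≤ π := by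
  have h1 := arctan_lt_pi_div_two a
  have h2 := arctan_lt_pi_div_two b
  have h3 := neg_pi_div_two_lt_arctan a
  have h4 := neg_pi_div_two_lt_arctan b
  exact abs_le.2 ⟨by linarith, by linarith⟩

lemma flux_term_le {p k c w a b : ℝ} (hp : p ∈ Icc (0 : ℝ) 1) (hk : |k| ≤ c) (hc : c ≤ 1) :
    -((2 * p * k * (w / √(1 + w ^ 2)) + p ^ 2 * ((a - b) / √(1 + w ^ 2) ^ 3)) *
      (arctan a - arctan b)) ≤ min (2 * π * c) (7 * c * softAbs w) := by
  have hD := abs_arctan_sub_le a b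
  have hD2 := sq_arctan_sub_le a b
  have hq := one_le_sqrt_one_add_sq w
  have hsq : √(1 + w ^ 2) ^ 2 = 1 + w ^ 2 := Real.sq_sqrt (by positivity)
  unfold softAbs
  set D := arctan a - arctan b
  set q := √(1 + w ^ 2)
  have hq0 : 0 < q := by linarith
  have hk0 : 0 ≤ |k| := abs_nonneg k
  have hc0 : 0 ≤ c := hk0.trans hk
  have hgood : p ^ 2 * D ^ 2 / q ^ 3 ≤ p ^ 2 * ((a - b) / q ^ 3) * D := by
    rw [show p ^ 2 * ((a - b) / q ^ 3) * D = p ^ 2 * ((a - b) * D) / q ^ 3 by ring]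
    gcongr
  have hgood0 : 0 ≤ p ^ 2 * D ^ 2 / q ^ 3 := by positivity
  have hwq : |w / q| ≤ 1 := by
    rw [abs_div, abs_of_pos hq0, div_le_one hq0]
    exact abs_le_of_sq_le_sq (by linarith) hq0.le
  have hbad : |2 * p * k * (w / q) * D| ≤ 2 * π * c := by
    rw [abs_mul, abs_mul, abs_mul, abs_mul, abs_of_nonneg hp.1, abs_two]
    calc 2 * p * |k| * |w / q| * |D| ≤ 2 * 1 * c * 1 * π := by
          gcongr
          exact hp.2
      _ = 2 * π * c := by ring
  have hbad' := (abs_le.1 hbad).1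
  refine le_min (by nlinarith) ?_
  rcases le_total q 2 with hq2 | hq2
  · have hamgm : -(2 * p * k * (w / q) * D) ≤ p ^ 2 * D ^ 2 / q ^ 3 + k ^ 2 * w ^ 2 * q := by
      have h : 0 ≤ (p * D + k * w * q ^ 2) ^ 2 / q ^ 3 := by positivity
      have e : (p * D + k * w * q ^ 2) ^ 2 / q ^ 3 =
          p ^ 2 * D ^ 2 / q ^ 3 + k ^ 2 * w ^ 2 * q + 2 * p * k * (w / q) * D := by
        field_simp
        ring
      linarith
    have hk2 : k ^ 2 ≤ c := by
      rw [← sq_abs]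
      nlinarith
    have hw : w ^ 2 * q ≤ 7 * (q - 1) := by
      have : w ^ 2 = (q - 1) * (q + 1) := by linarith
      rw [this]
      nlinarith [mul_nonneg (sub_nonneg.2 hq) (sub_nonneg.2 hq2)]
    have : k ^ 2 * w ^ 2 * q ≤ 7 * c * (q - 1) := by
      calc k ^ 2 * w ^ 2 * q = k ^ 2 * (w ^ 2 * q) := by ring
        _ ≤ c * (7 * (q - 1)) := by gcongr
        _ = 7 * c * (q - 1) := by ring
    linarith
  · have hpi : π ≤ 3.5 := by linarith [Real.pi_lt_d2]
    have : 2 * π * c ≤ 7 * c * (q - 1) := by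
      have : 2 * π ≤ 7 * (q - 1) := by linarith
      nlinarith
    linarith

lemma continuous_flux_factor {f g : ℝ → ℝ} (hf : Continuous f) (hg : Continuous g) :
    Continuous (fun x => (f x - g x) / √(1 + (f x - g x) ^ 2)) :=
  (hf.sub hg).div (by fun_prop) (fun x => by positivity)

/-- Integration by parts for the difference of the curvature terms of two graphs. -/
lemma integral_cutoff_mul_eq {f g : ℝ → ℝ} (hf : ContDiff ℝ 2 f) (hg : ContDiff ℝ 2 g) {R : ℝ}
    (hR : 0 < R) :
    ∫ x in (-R)..R, cutoff R x ^ 2 * ((f x - g x) / √(1 + (f x - g x) ^ 2)) *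
      (deriv (deriv f) x / (1 + deriv f x ^ 2) - deriv (deriv g) x / (1 + deriv g x ^ 2)) =
    ∫ x in (-R)..R, -((2 * cutoff R x * (-(2 * x / R ^ 2)) *
      ((f x - g x) / √(1 + (f x - g x) ^ 2)) +
      cutoff R x ^ 2 * ((deriv f x - deriv g x) / √(1 + (f x - g x) ^ 2) ^ 3)) *
      (arctan (deriv f x) - arctan (deriv g x))) := by
  have hcut := continuous_cutoff R
  have hderiv : ∀ {h : ℝ → ℝ}, ContDiff ℝ 2 h → Continuous h ∧ Continuous (deriv h) ∧
      Continuous (deriv (deriv h)) ∧ (∀ x, HasDerivAt h (deriv h x) x) ∧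
      ∀ x, HasDerivAt (fun x => arctan (deriv h x)) (deriv (deriv h) x / (1 + deriv h x ^ 2)) x := by
    intro h hh
    have hh' : ContDiff ℝ 1 (deriv h) := hh.deriv' (n := 1)
    refine ⟨hh.continuous, hh'.continuous, hh'.continuous_deriv le_rfl,
      fun x => (hh.differentiable (by norm_num) x).hasDerivAt, fun x => ?_⟩
    refine (((hh'.differentiable (by norm_num) x).hasDerivAt).arctan).congr_deriv ?_
    ring
  obtain ⟨f0, f1, f2, df, daf⟩ := hderiv hf
  obtain ⟨g0, g1, g2, dg, dag⟩ := hderiv hg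
  have hfac := continuous_flux_factor f0 g0
  have hU : ∀ x, HasDerivAt
      (fun x => cutoff R x ^ 2 * ((f x - g x) / √(1 + (f x - g x) ^ 2)))
      (2 * cutoff R x * (-(2 * x / R ^ 2)) * ((f x - g x) / √(1 + (f x - g x) ^ 2)) +
      cutoff R x ^ 2 * ((deriv f x - deriv g x) / √(1 + (f x - g x) ^ 2) ^ 3)) x := by
    intro x
    have h1 := (hasDerivAt_cutoff R x).pow 2
    have h2 := (hasDerivAt_deriv_softAbs (f x - g x)).comp x ((df x).sub (dg x))
    refine (h1.mul h2).congr_deriv ?_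
    simp only [Function.comp, Pi.sub_apply, Pi.pow_apply]
    push_cast
    ring
  have key := intervalIntegral.integral_mul_deriv_eq_deriv_mul (a := -R) (b := R)
    (fun x _ => hU x) (fun x _ => (daf x).sub (dag x))
    (Continuous.intervalIntegrable (by
      have : Continuous fun x => (deriv f x - deriv g x) / √(1 + (f x - g x) ^ 2) ^ 3 :=
        (f1.sub g1).div (by fun_prop) (fun x => by positivity)
      fun_prop) _ _)
    (Continuous.intervalIntegrable (by
      have h1 : Continuous fun x => deriv (deriv f) x / (1 + deriv f x ^ 2) :=
        f2.div (by fun_prop) (fun x => by positivity)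
      have h2 : Continuous fun x => deriv (deriv g) x / (1 + deriv g x ^ 2) :=
        g2.div (by fun_prop) (fun x => by positivity)
      fun_prop) _ _)
  have e1 : cutoff R R = 0 := by simp [cutoff, hR.ne']
  have e2 : cutoff R (-R) = 0 := by simp [cutoff, hR.ne']
  rw [key, e1, e2, intervalIntegral.integral_neg]
  simp

lemma integral_cutoff_mul_le {f g : ℝ → ℝ} (hf : ContDiff ℝ 2 f) (hg : ContDiff ℝ 2 g) {R : ℝ}
    (hR : 2 ≤ R) :
    ∫ x in (-R)..R, cutoff R x ^ 2 * ((f x - g x) / √(1 + (f x - g x) ^ 2)) *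
      (deriv (deriv f) x / (1 + deriv f x ^ 2) - deriv (deriv g) x / (1 + deriv g x ^ 2)) ≤
    min (8 * π) (14 / R * ∫ x in (-R)..R, softAbs (f x - g x)) := by
  have hR0 : 0 < R := by linarith
  have f0 := hf.continuous
  have g0 := hg.continuous
  have f1 : Continuous (deriv f) := hf.continuous_deriv (by norm_num)
  have g1 : Continuous (deriv g) := hg.continuous_deriv (by norm_num)
  have hcut := continuous_cutoff R
  have hsoft := continuous_softAbs
  rw [integral_cutoff_mul_eq hf hg hR0]
  have hint : IntervalIntegrable (fun x => -((2 * cutoff R x * (-(2 * x / R ^ 2)) *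
      ((f x - g x) / √(1 + (f x - g x) ^ 2)) +
      cutoff R x ^ 2 * ((deriv f x - deriv g x) / √(1 + (f x - g x) ^ 2) ^ 3)) *
      (arctan (deriv f x) - arctan (deriv g x)))) MeasureTheory.volume (-R) R := by
    have h1 := continuous_flux_factor f0 g0
    have h2 : Continuous fun x => (deriv f x - deriv g x) / √(1 + (f x - g x) ^ 2) ^ 3 :=
      (f1.sub g1).div (by fun_prop) (fun x => by positivity)
    exact Continuous.intervalIntegrable (by fun_prop) _ _
  have hpt : ∀ x ∈ Icc (-R) R, -((2 * cutoff R x * (-(2 * x / R ^ 2)) *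
      ((f x - g x) / √(1 + (f x - g x) ^ 2)) +
      cutoff R x ^ 2 * ((deriv f x - deriv g x) / √(1 + (f x - g x) ^ 2) ^ 3)) *
      (arctan (deriv f x) - arctan (deriv g x))) ≤
      min (2 * π * (2 / R)) (7 * (2 / R) * softAbs (f x - g x)) := by
    intro x hx
    refine flux_term_le (cutoff_mem_Icc hR0 hx) ?_ ((div_le_one hR0).2 hR)
    rw [abs_neg, abs_div, abs_mul, abs_two, abs_of_pos (by positivity : 0 < R ^ 2),
      div_le_div_iff₀ (by positivity) hR0]
    nlinarith [abs_le.2 hx]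
  refine le_min ?_ ?_
  · have := intervalIntegral.integral_mono_on (by linarith : -R ≤ R) hint
      (continuous_const.intervalIntegrable _ _) (fun x hx => (hpt x hx).trans (min_le_left _ _))
    refine this.trans (le_of_eq ?_)
    rw [intervalIntegral.integral_const, smul_eq_mul]
    field_simp
    ring
  · have := intervalIntegral.integral_mono_on (by linarith : -R ≤ R) hint
      (Continuous.intervalIntegrable (by fun_prop) _ _)
      (fun x hx => (hpt x hx).trans (min_le_right _ _))
    refine this.trans (le_of_eq ?_)
    rw [intervalIntegral.integral_const_mul]
    ring

/-- Differentiation under the integral sign for a `C¹` integrand. -/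
lemma hasDerivAt_integral_of_contDiffOn_prod {H : ℝ → ℝ → ℝ} {S : Set ℝ} (hS : IsOpen S)
    (hH : ContDiffOn ℝ 1 (fun p : ℝ × ℝ => H p.1 p.2) (univ ×ˢ S)) (a b : ℝ) {t : ℝ}
    (ht : t ∈ S) :
    HasDerivAt (fun s => ∫ x in a..b, H x s) (∫ x in a..b, deriv (fun s => H x s) t) t := by
  have hopen : IsOpen ((univ : Set ℝ) ×ˢ S) := isOpen_univ.prod hS
  have hfd := hH.continuousOn_fderiv_of_isOpen hopen le_rfl
  have hd : ∀ x, ∀ s ∈ S, HasDerivAt (fun s => H x s)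
      (fderiv ℝ (fun p : ℝ × ℝ => H p.1 p.2) (x, s) (0, 1)) s := by
    intro x s hs
    have h1 : HasFDerivAt (fun p : ℝ × ℝ => H p.1 p.2) _ (x, s) :=
      ((hH.differentiableOn one_ne_zero).differentiableAt
        (hopen.mem_nhds (mk_mem_prod (mem_univ x) hs))).hasFDerivAt
    exact h1.comp_hasDerivAt (f := fun s => (x, s)) s
      ((hasDerivAt_const s x).prodMk (hasDerivAt_id' s))
  have hcont : ContinuousOn (fun p : ℝ × ℝ => deriv (fun s => H p.1 s) p.2) (univ ×ˢ S) :=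
    (hfd.clm_apply continuousOn_const).congr (fun p hp => (hd p.1 p.2 hp.2).deriv)
  have hslice : ∀ {Q : ℝ × ℝ → ℝ}, ContinuousOn Q (univ ×ˢ S) → ∀ s ∈ S,
      Continuous (fun x => Q (x, s)) := fun hQ s hs =>
    hQ.comp_continuous (by fun_prop) (fun x => mk_mem_prod (mem_univ x) hs)
  obtain ⟨ε, hε, hball⟩ := Metric.nhds_basis_closedBall.mem_iff.1 (hS.mem_nhds ht)
  obtain ⟨C, hC⟩ := (isCompact_uIcc.prod (isCompact_closedBall t ε)).exists_bound_of_continuousOn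
    (hcont.mono (prod_mono (subset_univ (uIcc a b)) hball))
  refine (intervalIntegral.hasDerivAt_integral_of_dominated_loc_of_deriv_le
    (F' := fun s x => deriv (fun s => H x s) s) (bound := fun _ => C)
    (Metric.closedBall_mem_nhds t hε) ?_ ?_ ?_ ?_ ?_ ?_).2
  · filter_upwards [hS.mem_nhds ht] with s hs
    exact (hslice hH.continuousOn s hs).aestronglyMeasurable
  · exact (hslice hH.continuousOn t ht).intervalIntegrable _ _
  · exact (hslice hcont t ht).aestronglyMeasurable
  · exact Eventually.of_forall fun x hx s hs =>
      hC (x, s) (mk_mem_prod (uIoc_subset_uIcc hx) hs)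
  · exact intervalIntegrable_const
  · exact Eventually.of_forall fun x _ s hs =>
      (hd x s (hball hs)).differentiableAt.hasDerivAt

/-- The cutoff integral over `[-R, R]` of the soft absolute value of `u₁ - u₂` at time `t`. -/
def energy (u₁ u₂ : ℝ → ℝ → ℝ) (R t : ℝ) : ℝ :=
  ∫ x in (-R)..R, cutoff R x ^ 2 * softAbs (u₁ x t - u₂ x t)

lemma contDiff_slice {u : ℝ → ℝ → ℝ} {S : Set ℝ}
    (hu : ContDiffOn ℝ (⊤ : ℕ∞) (fun p : ℝ × ℝ => u p.1 p.2) (univ ×ˢ S)) {t : ℝ} (ht : t ∈ S) :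
    ContDiff ℝ 2 (fun x => u x t) := by
  have h2 : ContDiffOn ℝ 2 (fun p : ℝ × ℝ => u p.1 p.2) (univ ×ˢ S) :=
    hu.of_le (WithTop.coe_le_coe.2 (le_top : (2 : ℕ∞) ≤ ⊤))
  exact h2.comp_contDiff (f := fun x => (x, t)) (contDiff_id.prodMk contDiff_const)
    (fun x => mk_mem_prod (mem_univ x) ht)

lemma differentiableAt_time {u : ℝ → ℝ → ℝ} {S : Set ℝ}
    (hu : ContDiffOn ℝ (⊤ : ℕ∞) (fun p : ℝ × ℝ => u p.1 p.2) (univ ×ˢ S)) {t : ℝ}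
    (ht : S ∈ nhds t) (x : ℝ) : DifferentiableAt ℝ (fun s => u x s) t := by
  have h : DifferentiableAt ℝ (fun p : ℝ × ℝ => u p.1 p.2) (x, t) :=
    (hu.differentiableOn (by simp)).differentiableAt (prod_mem_nhds univ_mem ht)
  exact h.comp (f := fun s => (x, s)) t (by fun_prop)

section Comparison

variable {T t : ℝ} {u₁ u₂ : ℝ → ℝ → ℝ}

lemma hasDerivAt_energy
    (hu₁ : ContDiffOn ℝ (⊤ : ℕ∞) (fun p : ℝ × ℝ => u₁ p.1 p.2) (univ ×ˢ Ioc 0 T))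
    (hu₂ : ContDiffOn ℝ (⊤ : ℕ∞) (fun p : ℝ × ℝ => u₂ p.1 p.2) (univ ×ˢ Ioc 0 T))
    (hflow₁ : IsCSFSolution u₁ (Ioc 0 T)) (hflow₂ : IsCSFSolution u₂ (Ioc 0 T))
    (R : ℝ) (ht : t ∈ Ioo 0 T) :
    HasDerivAt (energy u₁ u₂ R)
      (∫ x in (-R)..R, cutoff R x ^ 2 *
        ((u₁ x t - u₂ x t) / √(1 + (u₁ x t - u₂ x t) ^ 2)) *
        (deriv (deriv (fun y => u₁ y t)) x / (1 + deriv (fun y => u₁ y t) x ^ 2) -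
          deriv (deriv (fun y => u₂ y t)) x / (1 + deriv (fun y => u₂ y t) x ^ 2))) t := by
  have hsub : (univ : Set ℝ) ×ˢ Ioo 0 T ⊆ univ ×ˢ Ioc 0 T :=
    prod_mono Subset.rfl Ioo_subset_Ioc_self
  have hle : (1 : WithTop ℕ∞) ≤ ((⊤ : ℕ∞) : WithTop ℕ∞) := by exact_mod_cast le_top
  have hw : ContDiffOn ℝ 1 (fun p : ℝ × ℝ => u₁ p.1 p.2 - u₂ p.1 p.2) (univ ×ˢ Ioo 0 T) :=
    ((hu₁.of_le hle).mono hsub).sub ((hu₂.of_le hle).mono hsub)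
  have hcut : ContDiff ℝ 1 (fun p : ℝ × ℝ => cutoff R p.1 ^ 2) := by
    unfold cutoff
    fun_prop
  have hH : ContDiffOn ℝ 1
      (fun p : ℝ × ℝ => cutoff R p.1 ^ 2 * softAbs (u₁ p.1 p.2 - u₂ p.1 p.2))
      (univ ×ˢ Ioo 0 T) :=
    hcut.contDiffOn.mul (contDiff_softAbs.comp_contDiffOn hw)
  refine (hasDerivAt_integral_of_contDiffOn_prod
    (H := fun x s => cutoff R x ^ 2 * softAbs (u₁ x s - u₂ x s)) isOpen_Ioo hH (-R) R
    ht).congr_deriv ?_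
  refine intervalIntegral.integral_congr (fun x _ => ?_)
  have hnhds : Ioc 0 T ∈ nhds t := Ioc_mem_nhds ht.1 ht.2
  have d₁ := (differentiableAt_time hu₁ hnhds x).hasDerivAt
  have d₂ := (differentiableAt_time hu₂ hnhds x).hasDerivAt
  rw [hflow₁ x t (Ioo_subset_Ioc_self ht)] at d₁
  rw [hflow₂ x t (Ioo_subset_Ioc_self ht)] at d₂
  have := (((hasDerivAt_softAbs (u₁ x t - u₂ x t)).comp t (d₁.sub d₂)).const_mul
    (cutoff R x ^ 2)).deriv
  refine Eq.trans this ?_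
  ring

lemma energy_nonneg (u₁ u₂ : ℝ → ℝ → ℝ) {R : ℝ} (hR : 0 < R) (t : ℝ) : 0 ≤ energy u₁ u₂ R t :=
  intervalIntegral.integral_nonneg (by linarith)
    (fun x _ => mul_nonneg (sq_nonneg _) (softAbs_nonneg _))

lemma tendsto_energy_zero {u₀ : ℝ → ℝ}
    (hinit₁ : TendstoLocallyUniformly (fun t x => u₁ x t) u₀ (nhdsWithin 0 (Ioi 0)))
    (hinit₂ : TendstoLocallyUniformly (fun t x => u₂ x t) u₀ (nhdsWithin 0 (Ioi 0)))
    {R : ℝ} (hR : 0 < R) :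
    Tendsto (energy u₁ u₂ R) (nhdsWithin 0 (Ioi 0)) (nhds 0) := by
  have h₁ := tendstoLocallyUniformly_iff_forall_isCompact.1 hinit₁ _
    (isCompact_Icc (a := -R) (b := R))
  have h₂ := tendstoLocallyUniformly_iff_forall_isCompact.1 hinit₂ _
    (isCompact_Icc (a := -R) (b := R))
  rw [Metric.tendstoUniformlyOn_iff] at h₁ h₂
  rw [Metric.tendsto_nhds]
  intro ε hε
  have hδ : 0 < ε / (8 * R) := by positivity
  filter_upwards [h₁ _ hδ, h₂ _ hδ] with t ht₁ ht₂
  have hbound : ‖energy u₁ u₂ R t‖ ≤ ε / (4 * R) * |R - -R| := by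
    refine intervalIntegral.norm_integral_le_of_norm_le_const (fun x hx => ?_)
    rw [uIoc_of_le (by linarith)] at hx
    have hx' := Ioc_subset_Icc_self hx
    have hc := cutoff_mem_Icc hR hx'
    have hs := softAbs_le_abs (u₁ x t - u₂ x t)
    have hw : |u₁ x t - u₂ x t| ≤ ε / (4 * R) := by
      have e₁ := ht₁ x hx'
      have e₂ := ht₂ x hx'
      have h3 := dist_triangle_left (u₁ x t) (u₂ x t) (u₀ x)
      rw [Real.dist_eq (u₁ x t)] at h3
      have : ε / (4 * R) = ε / (8 * R) + ε / (8 * R) := by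
        field_simp
        norm_num
      linarith
    rw [Real.norm_of_nonneg (mul_nonneg (sq_nonneg _) (softAbs_nonneg _))]
    calc cutoff R x ^ 2 * softAbs (u₁ x t - u₂ x t) ≤ 1 * (ε / (4 * R)) := by
          gcongr
          · exact softAbs_nonneg _
          · exact pow_le_one₀ hc.1 hc.2
          · exact hs.trans hw
      _ = ε / (4 * R) := one_mul _
  rw [dist_zero_right]
  refine hbound.trans_lt ?_
  rw [abs_of_pos (by linarith)]
  have : ε / (4 * R) * (R - -R) = ε / 2 := by
    field_simp
    norm_num
  linarith

/-- A function on `(0, T)` vanishing at `0⁺` with derivative at most `M` is at most `M t`. -/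
lemma le_mul_of_deriv_le_of_tendsto_zero {E E' : ℝ → ℝ} {M : ℝ}
    (hE : ∀ t ∈ Ioo 0 T, HasDerivAt E (E' t) t) (hM : ∀ t ∈ Ioo 0 T, E' t ≤ M)
    (h0 : Tendsto E (nhdsWithin 0 (Ioi 0)) (nhds 0)) (ht : t ∈ Ioo 0 T) :
    E t ≤ M * t := by
  have hlim : Tendsto (fun s => E s + M * (t - s)) (nhdsWithin 0 (Ioi 0))
      (nhds (0 + M * (t - 0))) :=
    h0.add ((Continuous.tendsto (by fun_prop) 0).mono_left nhdsWithin_le_nhds :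
      Tendsto (fun s : ℝ => M * (t - s)) _ _)
  have hev : ∀ᶠ s in nhdsWithin (0 : ℝ) (Ioi 0), E t ≤ E s + M * (t - s) := by
    filter_upwards [Ioo_mem_nhdsGT ht.1] with s hs
    have := (convex_Ioo 0 T).image_sub_le_mul_sub_of_deriv_le (f := E) (C := M)
      (fun s hs => (hE s hs).continuousAt.continuousWithinAt)
      (fun s hs => (hE s (interior_subset hs)).differentiableAt.differentiableWithinAt)
      (fun s hs => by rw [(hE s (interior_subset hs)).deriv]; exact hM s (interior_subset hs))
      s ⟨hs.1, hs.2.trans ht.2⟩ t ht hs.2.le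
    linarith
  simpa using ge_of_tendsto hlim hev

lemma integral_softAbs_le_energy (h₁ : Continuous (fun x => u₁ x t))
    (h₂ : Continuous (fun x => u₂ x t)) {R : ℝ} (hR : 0 < R) :
    ∫ x in (-R)..R, softAbs (u₁ x t - u₂ x t) ≤ 2 * energy u₁ u₂ (2 * R) t := by
  have hsoft := continuous_softAbs
  have hcut := continuous_cutoff (2 * R)
  unfold energy
  rw [← intervalIntegral.integral_const_mul]
  calc ∫ x in (-R)..R, softAbs (u₁ x t - u₂ x t)
      ≤ ∫ x in (-R)..R, 2 * (cutoff (2 * R) x ^ 2 * softAbs (u₁ x t - u₂ x t)) := by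
        refine intervalIntegral.integral_mono_on (by linarith)
          (Continuous.intervalIntegrable (by fun_prop) _ _)
          (Continuous.intervalIntegrable (by fun_prop) _ _) (fun x hx => ?_)
        have hc : 3 / 4 ≤ cutoff (2 * R) x := by
          have h : x ^ 2 ≤ R ^ 2 := sq_le_sq' hx.1 hx.2
          have h' : x ^ 2 / (2 * R) ^ 2 ≤ 1 / 4 := by
            rw [div_le_div_iff₀ (by positivity) (by norm_num)]
            nlinarith
          unfold cutoff
          linarith
        nlinarith [softAbs_nonneg (u₁ x t - u₂ x t),
          mul_nonneg (softAbs_nonneg (u₁ x t - u₂ x t))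
            (by nlinarith : (0 : ℝ) ≤ 2 * cutoff (2 * R) x ^ 2 - 1)]
    _ ≤ ∫ x in (-(2 * R))..(2 * R), 2 * (cutoff (2 * R) x ^ 2 * softAbs (u₁ x t - u₂ x t)) := by
        refine intervalIntegral.integral_mono_interval (by linarith) (by linarith) (by linarith)
          (Eventually.of_forall fun x => ?_) (Continuous.intervalIntegrable (by fun_prop) _ _)
        exact mul_nonneg zero_le_two (mul_nonneg (sq_nonneg _) (softAbs_nonneg _))

lemma energy_mono (h₁ : Continuous (fun x => u₁ x t))
    (h₂ : Continuous (fun x => u₂ x t)) {r R : ℝ} (hr : 0 < r) (hrR : r ≤ R) :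
    energy u₁ u₂ r t ≤ energy u₁ u₂ R t := by
  have hsoft := continuous_softAbs
  have hcr := continuous_cutoff r
  have hcR := continuous_cutoff R
  calc energy u₁ u₂ r t ≤ ∫ x in (-r)..r, cutoff R x ^ 2 * softAbs (u₁ x t - u₂ x t) := by
        refine intervalIntegral.integral_mono_on (by linarith)
          (Continuous.intervalIntegrable (by fun_prop) _ _)
          (Continuous.intervalIntegrable (by fun_prop) _ _) (fun x hx => ?_)
        have := (cutoff_mem_Icc hr hx).1
        have := softAbs_nonneg (u₁ x t - u₂ x t)
        have := cutoff_mono hr hrR x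
        gcongr
    _ ≤ energy u₁ u₂ R t := by
        refine intervalIntegral.integral_mono_interval (by linarith) (by linarith) (by linarith)
          (Eventually.of_forall fun x => mul_nonneg (sq_nonneg _) (softAbs_nonneg _))
          (Continuous.intervalIntegrable (by fun_prop) _ _)

lemma energy_eq_zero {u₀ : ℝ → ℝ}
    (hu₁ : ContDiffOn ℝ (⊤ : ℕ∞) (fun p : ℝ × ℝ => u₁ p.1 p.2) (univ ×ˢ Ioc 0 T))
    (hu₂ : ContDiffOn ℝ (⊤ : ℕ∞) (fun p : ℝ × ℝ => u₂ p.1 p.2) (univ ×ˢ Ioc 0 T))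
    (hflow₁ : IsCSFSolution u₁ (Ioc 0 T)) (hflow₂ : IsCSFSolution u₂ (Ioc 0 T))
    (hinit₁ : TendstoLocallyUniformly (fun t x => u₁ x t) u₀ (nhdsWithin 0 (Ioi 0)))
    (hinit₂ : TendstoLocallyUniformly (fun t x => u₂ x t) u₀ (nhdsWithin 0 (Ioi 0)))
    {r : ℝ} (hr : 0 < r) (ht : t ∈ Ioo 0 T) : energy u₁ u₂ r t = 0 := by
  have hslice₁ : ∀ s ∈ Ioo 0 T, ContDiff ℝ 2 (fun x => u₁ x s) :=
    fun s hs => contDiff_slice hu₁ (Ioo_subset_Ioc_self hs)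
  have hslice₂ : ∀ s ∈ Ioo 0 T, ContDiff ℝ 2 (fun x => u₂ x s) :=
    fun s hs => contDiff_slice hu₂ (Ioo_subset_Ioc_self hs)
  have hbound : ∀ R, 2 ≤ R → ∀ s ∈ Ioo 0 T, energy u₁ u₂ R s ≤ 8 * π * T := by
    intro R hR s hs
    have := le_mul_of_deriv_le_of_tendsto_zero
      (fun s hs => hasDerivAt_energy hu₁ hu₂ hflow₁ hflow₂ R hs)
      (fun s hs => (integral_cutoff_mul_le (hslice₁ s hs) (hslice₂ s hs) hR).trans
        (min_le_left _ _)) (tendsto_energy_zero hinit₁ hinit₂ (by linarith)) hs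
    exact this.trans (by have := hs.2.le; gcongr)
  have hdecay : ∀ R, 2 ≤ R → energy u₁ u₂ R t ≤ 14 / R * (2 * (8 * π * T)) * t := by
    intro R hR
    refine le_mul_of_deriv_le_of_tendsto_zero
      (fun s hs => hasDerivAt_energy hu₁ hu₂ hflow₁ hflow₂ R hs)
      (fun s hs => (integral_cutoff_mul_le (hslice₁ s hs) (hslice₂ s hs) hR).trans
        ((min_le_right _ _).trans ?_)) (tendsto_energy_zero hinit₁ hinit₂ (by linarith)) ht
    have h := integral_softAbs_le_energy (hslice₁ s hs).continuous (hslice₂ s hs).continuous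
      (by linarith : 0 < R)
    have h' := hbound (2 * R) (by linarith) s hs
    gcongr
    linarith
  have hlim : Tendsto (fun R : ℝ => 14 / R * (2 * (8 * π * T)) * t) atTop (nhds 0) := by
    simpa using ((tendsto_const_nhds.div_atTop tendsto_id).mul_const (2 * (8 * π * T))).mul_const t
  refine le_antisymm (ge_of_tendsto hlim ?_) (energy_nonneg u₁ u₂ hr t)
  filter_upwards [eventually_ge_atTop 2, eventually_ge_atTop r] with R hR hrR
  exact (energy_mono (hslice₁ t ht).continuous (hslice₂ t ht).continuous hr hrR).trans (hdecay R hR)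

lemma eq_of_energy_eq_zero (h₁ : Continuous (fun x => u₁ x t))
    (h₂ : Continuous (fun x => u₂ x t)) (h : ∀ r, 0 < r → energy u₁ u₂ r t = 0) (x : ℝ) :
    u₁ x t = u₂ x t := by
  by_contra hne
  have hsoft := continuous_softAbs
  have hr : 0 < |x| + 1 := by positivity
  have hcut := continuous_cutoff (|x| + 1)
  have hpos : 0 < energy u₁ u₂ (|x| + 1) t := by
    refine intervalIntegral.integral_pos (by linarith) (Continuous.continuousOn (by fun_prop))
      (fun y _ => mul_nonneg (sq_nonneg _) (softAbs_nonneg _)) ⟨x, ?_, ?_⟩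
    · exact abs_le.1 (by linarith)
    · have hc : 0 < cutoff (|x| + 1) x := by
        refine sub_pos.2 ((div_lt_one (by positivity)).2 ?_)
        nlinarith [sq_abs x, abs_nonneg x]
      exact mul_pos (by positivity) (softAbs_pos (sub_ne_zero.2 hne))
  exact hpos.ne' (h _ hr)

end Comparison

/-- **Theorem 1.1 (Uniqueness of solutions to CSF).** Two smooth entire-graph
solutions of curve shortening flow on `ℝ × (0,T]` with the same Lipschitz
continuous initial data (attained locally uniformly as `t → 0⁺`) coincide. -/
theorem csf_uniqueness (T : ℝ) (hT : 0 < T) (u₁ u₂ : ℝ → ℝ → ℝ) (u₀ : ℝ → ℝ)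
    (hu₀ : ∃ K : NNReal, LipschitzWith K u₀)
    (hsmooth₁ : ContDiffOn ℝ (⊤ : ℕ∞) (fun p : ℝ × ℝ => u₁ p.1 p.2) (Set.univ ×ˢ Set.Ioc 0 T))
    (hsmooth₂ : ContDiffOn ℝ (⊤ : ℕ∞) (fun p : ℝ × ℝ => u₂ p.1 p.2) (Set.univ ×ˢ Set.Ioc 0 T))
    (hflow₁ : IsCSFSolution u₁ (Set.Ioc 0 T))
    (hflow₂ : IsCSFSolution u₂ (Set.Ioc 0 T))
    (hinit₁ : TendstoLocallyUniformly (fun t x => u₁ x t) u₀ (nhdsWithin 0 (Set.Ioi 0)))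
    (hinit₂ : TendstoLocallyUniformly (fun t x => u₂ x t) u₀ (nhdsWithin 0 (Set.Ioi 0))) :
    ∀ x : ℝ, ∀ t ∈ Set.Ioc 0 T, u₁ x t = u₂ x t := by
  intro x
  have hIoo : EqOn (fun t => u₁ x t) (fun t => u₂ x t) (Ioo 0 T) := fun t ht =>
    eq_of_energy_eq_zero (contDiff_slice hsmooth₁ (Ioo_subset_Ioc_self ht)).continuous
      (contDiff_slice hsmooth₂ (Ioo_subset_Ioc_self ht)).continuous
      (fun r hr => energy_eq_zero hsmooth₁ hsmooth₂ hflow₁ hflow₂ hinit₁ hinit₂ hr ht) x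
  have htime : ∀ {u : ℝ → ℝ → ℝ}, ContDiffOn ℝ (⊤ : ℕ∞) (fun p : ℝ × ℝ => u p.1 p.2)
      (univ ×ˢ Ioc 0 T) → ContinuousOn (fun t => u x t) (Ioc 0 T) := fun hu =>
    hu.continuousOn.comp (f := fun t => (x, t)) (by fun_prop)
      (fun t ht => mk_mem_prod (mem_univ x) ht)
  refine hIoo.of_subset_closure (htime hsmooth₁) (htime hsmooth₂) Ioo_subset_Ioc_self ?_
  rw [closure_Ioo hT.ne]
  exact Ioc_subset_Icc_self
end
end

section
/- Let T > 0 and let u₁, u₂ : ℝⁿ × (0,T] → ℝ be two smooth solutions of the graphical mean curvature flow equation that are rotationally symmetric, i.e., for i = 1,2 there exist functions φᵢ : [0,∞) × (0,T] → ℝ with uᵢ(x,t) = φᵢ(|x|,t) for all x, t. Suppose there is a Lipschitz continuous function u₀ : ℝⁿ → ℝ such that u₁(·,t) → u₀ and u₂(·,t) → u₀ locally uniformly on ℝⁿ as t → 0⁺. Then u₁ = u₂ on ℝⁿ × (0,T]. -/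
open Real Filter Set

noncomputable section

/-- The `i`-th spatial partial derivative of `f : ℝⁿ → ℝ`. -/
def pd (n : ℕ) (f : EuclideanSpace ℝ (Fin n) → ℝ) (i : Fin n)
    (x : EuclideanSpace ℝ (Fin n)) : ℝ :=
  fderiv ℝ f x (EuclideanSpace.single i 1)

/-- The second spatial partial derivative `∂ᵢ∂ⱼ f`. -/
def pd2 (n : ℕ) (f : EuclideanSpace ℝ (Fin n) → ℝ) (i j : Fin n)
    (x : EuclideanSpace ℝ (Fin n)) : ℝ :=
  pd n (fun y => pd n f j y) i x

/-- The squared norm `|Df|²` of the spatial gradient. -/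
def gradSq (n : ℕ) (f : EuclideanSpace ℝ (Fin n) → ℝ)
    (x : EuclideanSpace ℝ (Fin n)) : ℝ :=
  ∑ i, (pd n f i x) ^ 2

/-- The right-hand side of the graphical mean curvature flow equation:
`Σ_{i,j} (δ_{ij} − ∂ᵢf ∂ⱼf/(1+|Df|²)) ∂ᵢ∂ⱼf`. -/
def mcfRHS (n : ℕ) (f : EuclideanSpace ℝ (Fin n) → ℝ)
    (x : EuclideanSpace ℝ (Fin n)) : ℝ :=
  ∑ i, ∑ j, ((if i = j then (1 : ℝ) else 0)
    - pd n f i x * pd n f j x / (1 + gradSq n f x)) * pd2 n f i j x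

/-- `u : ℝⁿ × S → ℝ` (curried, space then time) solves the graphical mean
curvature flow on the time set `S`. -/
def IsMCFSolution (n : ℕ) (u : EuclideanSpace ℝ (Fin n) → ℝ → ℝ) (S : Set ℝ) : Prop :=
  ∀ x, ∀ t ∈ S, deriv (fun s => u x s) t = mcfRHS n (fun y => u y t) x

open scoped Topology

/-- `φ` is differentiable near `0`, with `φ'(0) = a` and `φ''(0) = b`. -/
def HasSecondJet (φ : ℝ → ℝ) (a b : ℝ) : Prop :=
  ∃ φ' : ℝ → ℝ, (∀ᶠ h in 𝓝 (0 : ℝ), HasDerivAt φ (φ' h) h) ∧ φ' 0 = a ∧ HasDerivAt φ' b 0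

lemma HasSecondJet.sub {φ ψ : ℝ → ℝ} {a b c d : ℝ} (h₁ : HasSecondJet φ a b)
    (h₂ : HasSecondJet ψ c d) : HasSecondJet (fun h => φ h - ψ h) (a - c) (b - d) := by
  obtain ⟨φ', hφ, rfl, hφ'⟩ := h₁
  obtain ⟨ψ', hψ, rfl, hψ'⟩ := h₂
  refine ⟨fun h => φ' h - ψ' h, ?_, rfl, hφ'.sub hψ'⟩
  filter_upwards [hφ, hψ] with h h1 h2 using h1.sub h2

lemma hasSecondJet_quadratic (a b c : ℝ) :
    HasSecondJet (fun h => a + b * h + c * h ^ 2) b (2 * c) := by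
  refine ⟨fun h => b + 2 * c * h, Eventually.of_forall fun h => ?_, by simp, ?_⟩
  · have := (((hasDerivAt_id h).const_mul b).const_add a).add
      (((hasDerivAt_id h).pow 2).const_mul c)
    refine this.congr_deriv ?_
    simp; ring
  · simpa using ((hasDerivAt_id (0 : ℝ)).const_mul (2 * c)).const_add b

lemma hasSecondJet_div_quadratic (M ρ m q : ℝ) (hρ : 0 < ρ) :
    HasSecondJet (fun h => M / (ρ - (2 * m * h + q * h ^ 2)))
      (2 * (M / ρ ^ 2) * m) (4 * (2 * M / ρ ^ 3) * m ^ 2 + 2 * (M / ρ ^ 2) * q) := by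
  have hd : ∀ h : ℝ, HasDerivAt (fun h : ℝ => ρ - (2 * m * h + q * h ^ 2))
      (-(2 * m + 2 * q * h)) h := fun h => by
    have := (((hasDerivAt_id h).const_mul (2 * m)).add
      (((hasDerivAt_id h).pow 2).const_mul q)).const_sub ρ
    refine this.congr_deriv ?_
    simp; ring
  have hpos : ∀ᶠ h in 𝓝 (0 : ℝ), ρ - (2 * m * h + q * h ^ 2) ≠ 0 := by
    refine (hd 0).continuousAt.eventually_ne ?_
    simpa using hρ.ne'
  refine ⟨fun h => M * (2 * m + 2 * q * h) / (ρ - (2 * m * h + q * h ^ 2)) ^ 2, ?_, ?_, ?_⟩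
  · filter_upwards [hpos] with h hh
    have := (hasDerivAt_const h M).div (hd h) hh
    refine this.congr_deriv ?_
    ring
  · simp; ring
  · have h1 : HasDerivAt (fun h : ℝ => M * (2 * m + 2 * q * h)) (M * (2 * q)) 0 := by
      simpa using (((hasDerivAt_id (0 : ℝ)).const_mul (2 * q)).const_add (2 * m)).const_mul M
    have := h1.div ((hd 0).pow 2) (by simpa using hρ.ne')
    refine this.congr_deriv ?_
    simp
    field_simp
    ring

lemma HasSecondJet.of_isLocalMax {φ : ℝ → ℝ} {a b : ℝ} (h : HasSecondJet φ a b)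
    (hmax : IsLocalMax φ 0) : a = 0 ∧ b ≤ 0 := by
  obtain ⟨φ', hφ, rfl, hφ'⟩ := h
  have h0 : φ' 0 = 0 := hmax.hasDerivAt_eq_zero hφ.self_of_nhds
  refine ⟨h0, ?_⟩
  by_contra! hb
  have hderiv : deriv φ =ᶠ[𝓝 0] φ' := hφ.mono fun h hh => hh.deriv
  have hdd : deriv (deriv φ) 0 = b := hderiv.deriv_eq.trans hφ'.deriv
  have hmin : IsLocalMin φ 0 := isLocalMin_of_deriv_deriv_pos (hdd ▸ hb)
    (hφ.self_of_nhds.deriv.trans h0) hφ.self_of_nhds.continuousAt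
  have hconst : φ =ᶠ[𝓝 0] fun _ => φ 0 := by
    filter_upwards [hmax, hmin] with h h1 h2 using le_antisymm h1 h2
  have : deriv (deriv φ) 0 = 0 := by
    rw [hconst.deriv.deriv_eq]; simp
  linarith

lemma hasSecondJet_line {E : Type*} [NormedAddCommGroup E] [NormedSpace ℝ E] {f : E → ℝ} {x : E}
    (hf : ContDiffAt ℝ 2 f x) (ξ : E) :
    HasSecondJet (fun h => f (x + h • ξ)) (fderiv ℝ f x ξ) (fderiv ℝ (fderiv ℝ f) x ξ ξ) := by
  have hline : ∀ h : ℝ, HasDerivAt (fun h : ℝ => x + h • ξ) ξ h := fun h => by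
    simpa using ((hasDerivAt_id h).smul_const ξ).const_add x
  have hev : ∀ᶠ y in 𝓝 x, DifferentiableAt ℝ f y := by
    filter_upwards [hf.eventually (by simp)] with y hy using hy.differentiableAt (by simp)
  have htend : Tendsto (fun h : ℝ => x + h • ξ) (𝓝 0) (𝓝 x) := by
    simpa using (hline 0).continuousAt.tendsto
  refine ⟨fun h => fderiv ℝ f (x + h • ξ) ξ, ?_, by simp, ?_⟩
  · filter_upwards [htend.eventually hev] with h hh
    exact hh.hasFDerivAt.comp_hasDerivAt h (hline h)
  · have hd : DifferentiableAt ℝ (fderiv ℝ f) x :=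
      (hf.fderiv_right (m := 1) (by norm_num)).differentiableAt (by simp)
    have h1 : HasFDerivAt (fderiv ℝ f) (fderiv ℝ (fderiv ℝ f) x) (x + (0 : ℝ) • ξ) := by
      simpa using hd.hasFDerivAt
    have h2 := h1.comp_hasDerivAt (0 : ℝ) (hline 0)
    simpa using h2.clm_apply (hasDerivAt_const (0 : ℝ) ξ)

lemma HasDerivAt.nonneg_of_eventually_le_left {φ : ℝ → ℝ} {d t : ℝ} (h : HasDerivAt φ d t)
    (hle : ∀ᶠ s in 𝓝[<] t, φ s ≤ φ t) : 0 ≤ d := by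
  have h1 := (hasDerivWithinAt_iff_tendsto_slope' (s := Iio t) (by simp)).1 h.hasDerivWithinAt
  refine ge_of_tendsto h1 ?_
  filter_upwards [hle, self_mem_nhdsWithin] with s hs hst
  rw [slope_def_field]
  exact div_nonneg_of_nonpos (by linarith) (by simpa using le_of_lt hst)

/-- Vectors `σₖ(p)` with `∑ₖ σₖ ⊗ σₖ = I - p ⊗ p / (1 + |p|²)`. -/
def mcfFrame (n : ℕ) (p : EuclideanSpace ℝ (Fin n)) :
    Option (Fin n) → EuclideanSpace ℝ (Fin n)
  | none => (1 + ‖p‖ ^ 2)⁻¹ • p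
  | some k => EuclideanSpace.single k 1 - (p k * (1 + ‖p‖ ^ 2)⁻¹) • p

lemma continuous_mcfFrame (n : ℕ) : Continuous (mcfFrame n) := by
  have h : ∀ p : EuclideanSpace ℝ (Fin n), 1 + ‖p‖ ^ 2 ≠ 0 := fun p => by positivity
  refine continuous_pi fun k => ?_
  cases k with
  | none =>
    change Continuous fun p : EuclideanSpace ℝ (Fin n) => (1 + ‖p‖ ^ 2)⁻¹ • p
    fun_prop (disch := assumption)
  | some k =>
    change Continuous fun p : EuclideanSpace ℝ (Fin n) =>
      EuclideanSpace.single k 1 - (p k * (1 + ‖p‖ ^ 2)⁻¹) • p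
    fun_prop (disch := assumption)

lemma sum_single_apply {n : ℕ} (L : EuclideanSpace ℝ (Fin n) →L[ℝ] ℝ)
    (p : EuclideanSpace ℝ (Fin n)) :
    ∑ i, p i * L (EuclideanSpace.single i 1) = L p := by
  have h := (EuclideanSpace.basisFun (Fin n) ℝ).sum_repr p
  conv_rhs => rw [← h]
  simp

lemma sum_mcfFrame {n : ℕ} (p : EuclideanSpace ℝ (Fin n))
    (B : EuclideanSpace ℝ (Fin n) →L[ℝ] EuclideanSpace ℝ (Fin n) →L[ℝ] ℝ) :
    ∑ k, B (mcfFrame n p k) (mcfFrame n p k) =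
      ∑ i, B (EuclideanSpace.single i 1) (EuclideanSpace.single i 1)
        - B p p / (1 + ‖p‖ ^ 2) := by
  have hv : 1 + ‖p‖ ^ 2 ≠ 0 := by positivity
  have hp : ∑ i, p i ^ 2 = ‖p‖ ^ 2 := (EuclideanSpace.real_norm_sq_eq p).symm
  have h1 : ∑ i, p i * B (EuclideanSpace.single i 1) p = B p p := by
    simpa using sum_single_apply (B.flip p) p
  have h2 : ∑ i, p i * B p (EuclideanSpace.single i 1) = B p p := sum_single_apply (B p) p
  set c := (1 + ‖p‖ ^ 2)⁻¹ with hc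
  have h3 : ∀ k : Fin n, B (mcfFrame n p (some k)) (mcfFrame n p (some k)) =
      B (EuclideanSpace.single k 1) (EuclideanSpace.single k 1)
      - c * (p k * B (EuclideanSpace.single k 1) p) - c * (p k * B p (EuclideanSpace.single k 1))
      + p k ^ 2 * (c ^ 2 * B p p) := fun k => by
    simp only [mcfFrame, map_sub, map_smul, sub_apply,
      smul_apply, smul_eq_mul, ← hc]
    ring
  have h4 : B (mcfFrame n p none) (mcfFrame n p none) = c ^ 2 * B p p := by
    simp only [mcfFrame, map_smul, smul_apply, smul_eq_mul, ← hc]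
    ring
  rw [Fintype.sum_option, h4]
  simp_rw [h3]
  rw [Finset.sum_add_distrib, Finset.sum_sub_distrib, Finset.sum_sub_distrib, ← Finset.mul_sum,
    ← Finset.mul_sum, ← Finset.sum_mul, h1, h2, hp, hc]
  field_simp
  ring

lemma sum_norm_sq_mcfFrame {n : ℕ} (p : EuclideanSpace ℝ (Fin n)) :
    ∑ k, ‖mcfFrame n p k‖ ^ 2 = n - ‖p‖ ^ 2 / (1 + ‖p‖ ^ 2) := by
  have h : ∑ k, inner ℝ (mcfFrame n p k) (mcfFrame n p k) =
      ∑ i : Fin n, inner ℝ (EuclideanSpace.single i (1 : ℝ)) (EuclideanSpace.single i (1 : ℝ))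
        - inner ℝ p p / (1 + ‖p‖ ^ 2) := sum_mcfFrame p (innerSL ℝ)
  simp only [real_inner_self_eq_norm_sq] at h
  simpa using h

lemma sum_inner_sq_mcfFrame {n : ℕ} (p z : EuclideanSpace ℝ (Fin n)) :
    ∑ k, (inner ℝ z (mcfFrame n p k)) ^ 2 = ‖z‖ ^ 2 - (inner ℝ z p) ^ 2 / (1 + ‖p‖ ^ 2) := by
  have h := sum_mcfFrame p ((innerSL ℝ z).smulRight (innerSL ℝ z))
  simp only [ContinuousLinearMap.smulRight_apply, smul_apply,
    innerSL_apply_apply, smul_eq_mul, ← sq] at h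
  rw [h, EuclideanSpace.real_norm_sq_eq z]
  simp [EuclideanSpace.inner_single_right]

lemma mcfRHS_eq_sum_mcfFrame {n : ℕ} {f : EuclideanSpace ℝ (Fin n) → ℝ}
    {x p : EuclideanSpace ℝ (Fin n)} (hf : ContDiffAt ℝ 2 f x)
    (hp : ∀ ξ, fderiv ℝ f x ξ = inner ℝ p ξ) :
    mcfRHS n f x = ∑ k, fderiv ℝ (fderiv ℝ f) x (mcfFrame n p k) (mcfFrame n p k) := by
  have hd : DifferentiableAt ℝ (fderiv ℝ f) x :=
    (hf.fderiv_right (m := 1) (by norm_num)).differentiableAt (by simp)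
  have hpd : ∀ i, pd n f i x = p i := fun i => by
    simp [pd, hp, EuclideanSpace.inner_single_right]
  have hpd2 : ∀ i j, pd2 n f i j x =
      fderiv ℝ (fderiv ℝ f) x (EuclideanSpace.single i 1) (EuclideanSpace.single j 1) := by
    intro i j
    simp only [pd2, pd]
    rw [fderiv_clm_apply hd (by fun_prop)]
    simp
  set B := fderiv ℝ (fderiv ℝ f) x
  have hg : gradSq n f x = ‖p‖ ^ 2 := by simp [gradSq, hpd, EuclideanSpace.real_norm_sq_eq]
  have hB : ∑ i, ∑ j, p i * p j * B (EuclideanSpace.single i 1) (EuclideanSpace.single j 1)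
      = B p p := by
    simp_rw [mul_assoc, ← Finset.mul_sum, sum_single_apply]
    simpa using sum_single_apply (B.flip p) p
  rw [sum_mcfFrame, ← hB]
  simp only [mcfRHS, hpd, hpd2, hg, sub_mul, Finset.sum_sub_distrib, Finset.sum_div]
  congr 1
  · simp
  · refine Finset.sum_congr rfl fun i _ => Finset.sum_congr rfl fun j _ => by ring

/-- A solution of graphical mean curvature flow on `ℝⁿ × (0,T)` that is jointly `C²`. -/
structure IsRegularMCF (n : ℕ) (T : ℝ) (u : EuclideanSpace ℝ (Fin n) → ℝ → ℝ) : Prop where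
  contDiffAt : ∀ x, ∀ t ∈ Ioo 0 T,
    ContDiffAt ℝ 2 (fun p : EuclideanSpace ℝ (Fin n) × ℝ => u p.1 p.2) (x, t)
  flow : IsMCFSolution n u (Ioo 0 T)

namespace IsRegularMCF

variable {n : ℕ} {T : ℝ} {u : EuclideanSpace ℝ (Fin n) → ℝ → ℝ}

lemma contDiffAt_space (hu : IsRegularMCF n T u) (x : EuclideanSpace ℝ (Fin n)) {t : ℝ}
    (ht : t ∈ Ioo 0 T) : ContDiffAt ℝ 2 (fun y => u y t) x :=
  (hu.contDiffAt x t ht).comp x (f := fun y => (y, t)) (by fun_prop)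

lemma hasDerivAt_time (hu : IsRegularMCF n T u) (x : EuclideanSpace ℝ (Fin n)) {t : ℝ}
    (ht : t ∈ Ioo 0 T) : HasDerivAt (fun s => u x s) (mcfRHS n (fun y => u y t) x) t := by
  rw [← hu.flow x t ht]
  have h : ContDiffAt ℝ 2 (fun s => u x s) t :=
    (hu.contDiffAt x t ht).comp t (f := fun s => (x, s)) (by fun_prop)
  exact (h.differentiableAt (by simp)).hasDerivAt

lemma continuousAt (hu : IsRegularMCF n T u) (x : EuclideanSpace ℝ (Fin n)) {t : ℝ}
    (ht : t ∈ Ioo 0 T) :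
    ContinuousAt (fun p : EuclideanSpace ℝ (Fin n) × ℝ => u p.1 p.2) (x, t) :=
  (hu.contDiffAt x t ht).continuousAt

lemma neg (hu : IsRegularMCF n T u) : IsRegularMCF n T (fun x t => -u x t) := by
  refine ⟨fun x t ht => (hu.contDiffAt x t ht).neg, fun x t ht => ?_⟩
  have hpd : ∀ (f : EuclideanSpace ℝ (Fin n) → ℝ) i x, pd n (fun y => -f y) i x = -pd n f i x := by
    intro f i x
    simp [pd, fderiv_fun_neg]
  rw [deriv.fun_neg, hu.flow x t ht]
  simp [mcfRHS, pd2, gradSq, hpd]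

end IsRegularMCF

lemma rhs_barrier_le {N M ρ R Z a v : ℝ} (hM : R ^ 3 ≤ M) (hR : 0 < R) (hρ : 0 < ρ)
    (hρR : ρ ≤ R ^ 2) (hZ : 0 ≤ Z) (ha : a = M / ρ ^ 2) (hv : v = 1 + 4 * a ^ 2 * Z) :
    4 * (2 * M / ρ ^ 3) * (Z - (2 * a * Z) ^ 2 / v) + 2 * a * (N - 4 * a ^ 2 * Z / v)
      ≤ 2 * a * N := by
  have hvpos : 0 < v := by rw [hv]; positivity
  have hM0 : 0 < M := lt_of_lt_of_le (by positivity) hM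
  have h1 : Z - (2 * a * Z) ^ 2 / v = Z / v := by
    field_simp
    rw [hv]; ring
  have h3 : ρ ^ 3 ≤ M ^ 2 := calc
    ρ ^ 3 ≤ (R ^ 2) ^ 3 := by gcongr
    _ = (R ^ 3) ^ 2 := by ring
    _ ≤ M ^ 2 := by gcongr
  have h2 : M / ρ ^ 3 ≤ a ^ 3 := by
    rw [ha, div_pow, div_le_div_iff₀ (by positivity) (by positivity)]
    nlinarith [mul_le_mul_of_nonneg_left h3 (by positivity : 0 ≤ M * ρ ^ 3)]
  rw [h1]
  have h4 := mul_le_mul_of_nonneg_right h2 (by positivity : 0 ≤ Z / v)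
  have e1 : 4 * (2 * M / ρ ^ 3) * (Z / v) = 8 * (M / ρ ^ 3 * (Z / v)) := by ring
  have e2 : 2 * a * (N - 4 * a ^ 2 * Z / v) = 2 * a * N - 8 * (a ^ 3 * (Z / v)) := by ring
  rw [e1, e2]
  linarith

set_option maxHeartbeats 1000000 in
/-- A solution with Lipschitz initial data rises at most like `√t`. -/
lemma IsRegularMCF.le_initial_add_sqrt {n : ℕ} {T K : ℝ} {u : EuclideanSpace ℝ (Fin n) → ℝ → ℝ}
    {u₀ : EuclideanSpace ℝ (Fin n) → ℝ} (hu : IsRegularMCF n T u) (hK : 0 ≤ K)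
    (hu₀ : ∀ x y, u₀ x - u₀ y ≤ K * ‖x - y‖)
    (hinit : TendstoLocallyUniformly (fun t x => u x t) u₀ (𝓝[>] 0))
    (x₀ : EuclideanSpace ℝ (Fin n)) {τ : ℝ} (hτ : τ ∈ Ioo 0 T) :
    u x₀ τ ≤ u₀ x₀ + (K + 2) * √(2 * (2 * n + 1) * τ) := by
  by_contra! hlt
  set c : ℝ := 2 * n + 1 with hc
  have hcpos : 0 < c := by positivity
  have hτ0 : 0 < τ := hτ.1
  set R := √(2 * c * τ) with hRdef
  have hR : 0 < R := by positivity
  have hR2 : R ^ 2 = 2 * c * τ := Real.sq_sqrt (by positivity)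
  set A := u₀ x₀ + K * R with hA
  obtain ⟨t₀, ht₀, ht₀τ⟩ : ∃ t₀ ∈ Ioo 0 τ, ∀ x ∈ Metric.closedBall x₀ R, u x t₀ < A + R / 2 := by
    have h1 := (tendstoLocallyUniformlyOn_iff_tendstoUniformlyOn_of_compact
      (isCompact_closedBall x₀ R)).1 (hinit.tendstoLocallyUniformlyOn (s := Metric.closedBall x₀ R))
    have h2 := Metric.tendstoUniformlyOn_iff.1 h1 (R / 2) (by positivity)
    obtain ⟨t₀, h3, h4⟩ := (h2.and (Ioo_mem_nhdsGT hτ0)).exists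
    refine ⟨t₀, h4, fun x hx => ?_⟩
    have h5 := abs_lt.1 (Real.dist_eq _ _ ▸ h3 x hx)
    have h6 := hu₀ x x₀
    have h7 : K * ‖x - x₀‖ ≤ K * R := by
      gcongr
      simpa [dist_eq_norm] using hx
    linarith [h5.1]
  set F : EuclideanSpace ℝ (Fin n) × ℝ → ℝ :=
    fun p => (u p.1 p.2 - A) * (R ^ 2 - ‖p.1 - x₀‖ ^ 2 - c * p.2) with hF
  set S : Set (EuclideanSpace ℝ (Fin n) × ℝ) :=
    {p | p.2 ∈ Icc t₀ τ ∧ ‖p.1 - x₀‖ ^ 2 + c * p.2 ≤ R ^ 2} with hS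
  have hball : ∀ p ∈ S, p.1 ∈ Metric.closedBall x₀ R := by
    intro p hp
    have : 0 ≤ c * p.2 := mul_nonneg hcpos.le (ht₀.1.le.trans hp.1.1)
    rw [Metric.mem_closedBall, dist_eq_norm]
    exact le_of_sq_le_sq (by linarith [hp.2]) hR.le
  have hScomp : IsCompact S := by
    refine ((isCompact_closedBall x₀ R).prod (isCompact_Icc (a := t₀) (b := τ))).of_isClosed_subset
      ?_ fun p hp => ⟨hball p hp, hp.1⟩
    refine IsClosed.inter (isClosed_Icc.preimage continuous_snd) ?_
    have h1 : Continuous fun p : EuclideanSpace ℝ (Fin n) × ℝ => ‖p.1 - x₀‖ ^ 2 + c * p.2 := by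
      fun_prop
    exact isClosed_le h1 continuous_const
  have hIoo : ∀ {t}, t ∈ Icc t₀ τ → t ∈ Ioo 0 T :=
    fun ht => ⟨ht₀.1.trans_le ht.1, ht.2.trans_lt hτ.2⟩
  have hFcont : ContinuousOn F S := by
    intro p hp
    have h1 := hu.continuousAt p.1 (hIoo hp.1)
    exact ((h1.sub continuousAt_const).mul (by fun_prop)).continuousWithinAt
  have hmem : (x₀, τ) ∈ S := ⟨⟨ht₀.2.le, le_rfl⟩, by simp [hR2]; nlinarith⟩
  obtain ⟨⟨x, t⟩, hxS, hmax⟩ := hScomp.exists_isMaxOn ⟨_, hmem⟩ hFcont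
  set M := F (x, t) with hM
  have hMgt : R ^ 3 < M := by
    refine lt_of_lt_of_le ?_ (hmax hmem)
    have h1 : R ^ 2 - ‖x₀ - x₀‖ ^ 2 - c * τ = R ^ 2 / 2 := by rw [hR2]; simp; ring
    change R ^ 3 < (u x₀ τ - A) * (R ^ 2 - ‖x₀ - x₀‖ ^ 2 - c * τ)
    rw [h1]
    have h2 : 2 * R < u x₀ τ - A := by rw [hA]; linarith
    nlinarith [mul_lt_mul_of_pos_right h2 (by positivity : 0 < R ^ 2 / 2)]
  have hMpos : 0 < M := lt_trans (by positivity) hMgt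
  have htI := hIoo hxS.1
  set ρ := R ^ 2 - ‖x - x₀‖ ^ 2 - c * t with hρdef
  have hMρ : M = (u x t - A) * ρ := rfl
  have hρ0 : 0 ≤ ρ := by have := hxS.2; simp only at this; linarith
  have hρ : 0 < ρ := hρ0.lt_of_ne (by rintro h; rw [hMρ, ← h] at hMpos; simp at hMpos)
  have hρR : ρ ≤ R ^ 2 := by
    have : 0 < c * t := mul_pos hcpos htI.1
    nlinarith [sq_nonneg ‖x - x₀‖]
  have huA : u x t - A = M / ρ := by rw [hMρ]; field_simp
  have htne : t₀ < t := by
    refine lt_of_le_of_ne hxS.1.1 ?_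
    intro ht
    have h1 : u x t < A + R / 2 := by
      rw [← ht]
      exact ht₀τ x (hball (x, t) hxS)
    have h2 : M ≤ R / 2 * ρ := by
      rw [hMρ]
      exact mul_le_mul_of_nonneg_right (by linarith) hρ0
    nlinarith [mul_le_mul_of_nonneg_left hρR (by positivity : 0 ≤ R / 2), pow_pos hR 3]
  set z := x - x₀ with hz
  have hjet : ∀ ξ, fderiv ℝ (fun y => u y t) x ξ - 2 * (M / ρ ^ 2) * inner ℝ z ξ = 0 ∧
      fderiv ℝ (fderiv ℝ (fun y => u y t)) x ξ ξ - (4 * (2 * M / ρ ^ 3) * (inner ℝ z ξ) ^ 2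
        + 2 * (M / ρ ^ 2) * ‖ξ‖ ^ 2) ≤ 0 := by
    intro ξ
    refine ((hasSecondJet_line (hu.contDiffAt_space x htI) ξ).sub
      (hasSecondJet_div_quadratic M ρ (inner ℝ z ξ) (‖ξ‖ ^ 2) hρ)).of_isLocalMax ?_
    have hcont : ContinuousAt
        (fun h : ℝ => ρ - (2 * inner ℝ z ξ * h + ‖ξ‖ ^ 2 * h ^ 2)) 0 := by fun_prop
    filter_upwards [hcont.eventually (lt_mem_nhds (by simpa using hρ))] with h hh
    have he : R ^ 2 - ‖x + h • ξ - x₀‖ ^ 2 - c * t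
        = ρ - (2 * inner ℝ z ξ * h + ‖ξ‖ ^ 2 * h ^ 2) := by
      rw [show x + h • ξ - x₀ = z + h • ξ by rw [hz]; abel, norm_add_sq_real, norm_smul,
        inner_smul_right, mul_pow, Real.norm_eq_abs, sq_abs, hρdef]
      ring
    have hle : F (x + h • ξ, t) ≤ M :=
      hmax (show (x + h • ξ, t) ∈ S from ⟨hxS.1, by simp only; linarith⟩)
    have h2 : (u (x + h • ξ) t - A) * (ρ - (2 * inner ℝ z ξ * h + ‖ξ‖ ^ 2 * h ^ 2)) ≤ M := by
      rw [← he]; exact hle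
    have h3 := (le_div_iff₀ hh).2 h2
    simp only [zero_smul, add_zero, mul_zero, ne_eq, OfNat.ofNat_ne_zero, not_false_eq_true,
      zero_pow, sub_zero]
    linarith
  set a := M / ρ ^ 2 with ha
  have hapos : 0 < a := by positivity
  have hrhs := mcfRHS_eq_sum_mcfFrame (p := (2 * a) • z) (hu.contDiffAt_space x htI) fun ξ => by
    rw [real_inner_smul_left]; linarith [(hjet ξ).1]
  have hspace : mcfRHS n (fun y => u y t) x ≤ 2 * a * n := by
    have hp : ‖(2 * a) • z‖ ^ 2 = 4 * a ^ 2 * ‖z‖ ^ 2 := by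
      rw [norm_smul, mul_pow, Real.norm_eq_abs, sq_abs]; ring
    have h1 := Finset.sum_le_sum fun k (_ : k ∈ Finset.univ) =>
      sub_nonpos.1 (hjet (mcfFrame n ((2 * a) • z) k)).2
    rw [← hrhs, Finset.sum_add_distrib, ← Finset.mul_sum, ← Finset.mul_sum, sum_norm_sq_mcfFrame,
      sum_inner_sq_mcfFrame, real_inner_smul_right, real_inner_self_eq_norm_sq, hp] at h1
    exact h1.trans (rhs_barrier_le hMgt.le hR hρ hρR (sq_nonneg _) ha rfl)
  have htime : 0 ≤ mcfRHS n (fun y => u y t) x * ρ + (u x t - A) * (-c) := by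
    have h1 : HasDerivAt (fun s => F (x, s))
        (mcfRHS n (fun y => u y t) x * ρ + (u x t - A) * (-c)) t := by
      have h2 : HasDerivAt (fun s => R ^ 2 - ‖x - x₀‖ ^ 2 - c * s) (-c) t := by
        simpa using ((hasDerivAt_id t).const_mul c).const_sub (R ^ 2 - ‖x - x₀‖ ^ 2)
      exact ((hu.hasDerivAt_time x htI).sub_const A).mul h2
    refine h1.nonneg_of_eventually_le_left ?_
    filter_upwards [Ioo_mem_nhdsLT htne] with s hs
    refine hmax (show (x, s) ∈ S from ⟨⟨hs.1.le, hs.2.le.trans hxS.1.2⟩, ?_⟩)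
    have := hxS.2
    simp only at this ⊢
    nlinarith [hs.2]
  rw [huA] at htime
  have h5 : c * a * ρ ≤ mcfRHS n (fun y => u y t) x * ρ := by
    have : M / ρ = a * ρ := by rw [ha]; field_simp
    rw [this] at htime
    linarith
  have h6 := le_of_mul_le_mul_right h5 hρ
  rw [hc] at h6
  nlinarith

set_option maxHeartbeats 1000000 in
/-- Doubling of variables: a penalized maximum point of `u₁(x,t) - u₂(y,t)` and the first and
second order conditions holding there. -/
lemma exists_doubling_point {n : ℕ} {T K C α ε μ L τ : ℝ}
    {u₁ u₂ : EuclideanSpace ℝ (Fin n) → ℝ → ℝ}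
    (hu₁ : IsRegularMCF n T u₁) (hu₂ : IsRegularMCF n T u₂) (hC : 0 ≤ C)
    (hdiff : ∀ x y, ∀ t ∈ Ioo 0 T, u₁ x t - u₂ y t ≤ K * ‖x - y‖ + C * √t)
    (hα : 0 < α) (hε : 0 < ε) (hμ : 0 < μ) (hτ : τ ∈ Ioo 0 T) (hKL : K ^ 2 / (2 * α) < L)
    (x₀ : EuclideanSpace ℝ (Fin n)) (hL : L ≤ u₁ x₀ τ - u₂ x₀ τ - ε * ‖x₀‖ ^ 2 - μ * τ) :
    ∃ x y, ∃ t ∈ Ioo 0 T, ε * ‖x‖ ^ 2 ≤ C * √T + K ^ 2 / (2 * α) ∧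
      α / 2 * ‖x - y‖ ^ 2 ≤ C * √T + K ^ 2 / (2 * α) ∧
      μ ≤ mcfRHS n (fun z => u₁ z t) x - mcfRHS n (fun z => u₂ z t) y ∧
      ∀ ξ η, fderiv ℝ (fun z => u₁ z t) x ξ - fderiv ℝ (fun z => u₂ z t) y η =
          2 * α * inner ℝ (x - y) (ξ - η) + 2 * ε * inner ℝ x ξ ∧
        fderiv ℝ (fderiv ℝ (fun z => u₁ z t)) x ξ ξ - fderiv ℝ (fderiv ℝ (fun z => u₂ z t)) y η η
          ≤ 2 * α * ‖ξ - η‖ ^ 2 + 2 * ε * ‖ξ‖ ^ 2 := by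
  have hLpos : 0 < L := lt_of_le_of_lt (by positivity) hKL
  set M := C * √T + K ^ 2 / (2 * α) with hM
  have hM0 : 0 ≤ M := by positivity
  obtain ⟨t₀, ht₀L, ht₀⟩ : ∃ t₀, C * √t₀ + K ^ 2 / (2 * α) < L ∧ t₀ ∈ Ioo 0 τ := by
    have h1 : ContinuousAt (fun t : ℝ => C * √t + K ^ 2 / (2 * α)) 0 := by fun_prop
    have h2 := h1.tendsto.eventually_lt_const (u := L) (by simpa using hKL)
    exact ((h2.filter_mono nhdsWithin_le_nhds).and (Ioo_mem_nhdsGT hτ.1)).exists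
  set Φ : EuclideanSpace ℝ (Fin n) × EuclideanSpace ℝ (Fin n) × ℝ → ℝ := fun q =>
    u₁ q.1 q.2.2 - u₂ q.2.1 q.2.2 - α * ‖q.1 - q.2.1‖ ^ 2 - ε * ‖q.1‖ ^ 2 - μ * q.2.2 with hΦ
  have hIoo : ∀ {t}, t ∈ Icc t₀ τ → t ∈ Ioo 0 T :=
    fun ht => ⟨ht₀.1.trans_le ht.1, ht.2.trans_lt hτ.2⟩
  have hΦle : ∀ x y t, t ∈ Ioo 0 T →
      Φ (x, y, t) + α / 2 * ‖x - y‖ ^ 2 + ε * ‖x‖ ^ 2 ≤ C * √t + K ^ 2 / (2 * α) := by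
    intro x y t ht
    have h1 := hdiff x y t ht
    have h2 : K * ‖x - y‖ ≤ K ^ 2 / (2 * α) + α / 2 * ‖x - y‖ ^ 2 := by
      have h3 : K ^ 2 / (2 * α) + α / 2 * ‖x - y‖ ^ 2 - K * ‖x - y‖
          = (K - α * ‖x - y‖) ^ 2 / (2 * α) := by field_simp; ring
      have h4 : 0 ≤ (K - α * ‖x - y‖) ^ 2 / (2 * α) := by positivity
      linarith
    have h5 : 0 < μ * t := mul_pos hμ ht.1
    simp only [hΦ]
    linarith
  have hΦM : ∀ x y t, t ∈ Ioo 0 T → L ≤ Φ (x, y, t) →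
      ε * ‖x‖ ^ 2 ≤ M ∧ α / 2 * ‖x - y‖ ^ 2 ≤ M := by
    intro x y t ht hLΦ
    have h1 := hΦle x y t ht
    have h2 : C * √t ≤ C * √T :=
      mul_le_mul_of_nonneg_left (Real.sqrt_le_sqrt ht.2.le) hC
    have h3 : 0 ≤ ε * ‖x‖ ^ 2 := by positivity
    have h4 : 0 ≤ α / 2 * ‖x - y‖ ^ 2 := by positivity
    constructor <;> linarith
  set r := √(M / ε) + 1 with hr
  set r' := r + √(2 * M / α) + ‖x₀‖ with hr'
  have hx_lt : ∀ x : EuclideanSpace ℝ (Fin n), ε * ‖x‖ ^ 2 ≤ M → ‖x‖ < r := by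
    intro x hx
    have h1 : ‖x‖ ≤ √(M / ε) := Real.le_sqrt_of_sq_le (by rw [le_div_iff₀ hε]; linarith)
    linarith
  have hy_lt : ∀ x y : EuclideanSpace ℝ (Fin n), ε * ‖x‖ ^ 2 ≤ M →
      α / 2 * ‖x - y‖ ^ 2 ≤ M → ‖y‖ < r' := by
    intro x y hx hxy
    have h1 : ‖x - y‖ ≤ √(2 * M / α) := Real.le_sqrt_of_sq_le (by rw [le_div_iff₀ hα]; linarith)
    have h2 : ‖y‖ ≤ ‖x‖ + ‖x - y‖ := by
      simpa using norm_sub_le x (x - y)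
    have h3 := hx_lt x hx
    have h4 := norm_nonneg x₀
    linarith
  set S : Set (EuclideanSpace ℝ (Fin n) × EuclideanSpace ℝ (Fin n) × ℝ) :=
    Metric.closedBall 0 r ×ˢ Metric.closedBall 0 r' ×ˢ Icc t₀ τ with hS
  have hScomp : IsCompact S :=
    (isCompact_closedBall _ _).prod ((isCompact_closedBall _ _).prod isCompact_Icc)
  have hΦcont : ContinuousOn Φ S := by
    intro q hq
    have ht := hIoo hq.2.2
    have h1 : ContinuousAt (fun q : EuclideanSpace ℝ (Fin n) × EuclideanSpace ℝ (Fin n) × ℝ =>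
        u₁ q.1 q.2.2) q :=
      ContinuousAt.comp (f := fun q : EuclideanSpace ℝ (Fin n) × EuclideanSpace ℝ (Fin n) × ℝ =>
        (q.1, q.2.2)) (hu₁.continuousAt q.1 ht) (by fun_prop)
    have h2 : ContinuousAt (fun q : EuclideanSpace ℝ (Fin n) × EuclideanSpace ℝ (Fin n) × ℝ =>
        u₂ q.2.1 q.2.2) q :=
      ContinuousAt.comp (f := fun q : EuclideanSpace ℝ (Fin n) × EuclideanSpace ℝ (Fin n) × ℝ =>
        (q.2.1, q.2.2)) (hu₂.continuousAt q.2.1 ht) (by fun_prop)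
    exact ((((h1.sub h2).sub (by fun_prop)).sub (by fun_prop)).sub (by fun_prop)).continuousWithinAt
  have hΦ₀ : L ≤ Φ (x₀, x₀, τ) := by simpa [hΦ] using hL
  have hmem : (x₀, x₀, τ) ∈ S := by
    obtain ⟨h1, h2⟩ := hΦM x₀ x₀ τ hτ hΦ₀
    refine ⟨?_, ?_, ht₀.2.le, le_rfl⟩
    · simpa using (hx_lt x₀ h1).le
    · simpa using (hy_lt x₀ x₀ h1 h2).le
  obtain ⟨⟨x, y, t⟩, hxS, hmax⟩ := hScomp.exists_isMaxOn ⟨_, hmem⟩ hΦcont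
  have hLΦ : L ≤ Φ (x, y, t) := hΦ₀.trans (hmax hmem)
  have htI : t ∈ Icc t₀ τ := hxS.2.2
  have ht := hIoo htI
  obtain ⟨hxM, hxyM⟩ := hΦM x y t ht hLΦ
  have hxr := hx_lt x hxM
  have hyr := hy_lt x y hxM hxyM
  have htne : t₀ < t := by
    refine lt_of_le_of_ne htI.1 fun h => ?_
    have h1 := hΦle x y t ht
    rw [← h] at h1 hLΦ
    have h3 : 0 ≤ ε * ‖x‖ ^ 2 := by positivity
    have h4 : 0 ≤ α / 2 * ‖x - y‖ ^ 2 := by positivity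
    linarith
  refine ⟨x, y, t, ht, hxM, hxyM, ?_, fun ξ η => ?_⟩
  · have h1 : HasDerivAt (fun s => Φ (x, y, s))
        (mcfRHS n (fun z => u₁ z t) x - mcfRHS n (fun z => u₂ z t) y - μ) t := by
      have h2 : HasDerivAt (fun s : ℝ => μ * s) μ t := by
        simpa using (hasDerivAt_id t).const_mul μ
      exact ((((hu₁.hasDerivAt_time x ht).sub (hu₂.hasDerivAt_time y ht)).sub_const
        (α * ‖x - y‖ ^ 2)).sub_const (ε * ‖x‖ ^ 2)).sub h2
    have h2 : 0 ≤ mcfRHS n (fun z => u₁ z t) x - mcfRHS n (fun z => u₂ z t) y - μ := by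
      refine h1.nonneg_of_eventually_le_left ?_
      filter_upwards [Ioo_mem_nhdsLT htne] with s hs
      exact hmax (show (x, y, s) ∈ S from ⟨hxS.1, hxS.2.1, hs.1.le, hs.2.le.trans htI.2⟩)
    linarith
  · have hj := ((((hasSecondJet_line (hu₁.contDiffAt_space x ht) ξ).sub
      (hasSecondJet_line (hu₂.contDiffAt_space y ht) η)).sub
      (hasSecondJet_quadratic (α * ‖x - y‖ ^ 2) (2 * α * inner ℝ (x - y) (ξ - η))
        (α * ‖ξ - η‖ ^ 2))).sub
      (hasSecondJet_quadratic (ε * ‖x‖ ^ 2) (2 * ε * inner ℝ x ξ) (ε * ‖ξ‖ ^ 2))).of_isLocalMax ?_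
    · constructor <;> linarith [hj.1, hj.2]
    · have hcx : ContinuousAt (fun h : ℝ => ‖x + h • ξ‖) 0 := by fun_prop
      have hcy : ContinuousAt (fun h : ℝ => ‖y + h • η‖) 0 := by fun_prop
      filter_upwards [hcx.tendsto.eventually_lt_const (u := r) (by simpa using hxr),
        hcy.tendsto.eventually_lt_const (u := r') (by simpa using hyr)] with h hh1 hh2
      have hle : Φ (x + h • ξ, y + h • η, t) ≤ Φ (x, y, t) :=
        hmax (show (x + h • ξ, y + h • η, t) ∈ S from
          ⟨by simpa using hh1.le, by simpa using hh2.le, htI⟩)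
      have e1 : ‖x + h • ξ‖ ^ 2 = ‖x‖ ^ 2 + 2 * h * inner ℝ x ξ + h ^ 2 * ‖ξ‖ ^ 2 := by
        rw [norm_add_sq_real, norm_smul, inner_smul_right, mul_pow, Real.norm_eq_abs, sq_abs]
        ring
      have e2 : ‖x + h • ξ - (y + h • η)‖ ^ 2 =
          ‖x - y‖ ^ 2 + 2 * h * inner ℝ (x - y) (ξ - η) + h ^ 2 * ‖ξ - η‖ ^ 2 := by
        rw [show x + h • ξ - (y + h • η) = (x - y) + h • (ξ - η) by rw [smul_sub]; abel,
          norm_add_sq_real, norm_smul, inner_smul_right, mul_pow, Real.norm_eq_abs, sq_abs]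
        ring
      simp only [hΦ, e1, e2] at hle
      simp only [zero_smul, add_zero, mul_zero, ne_eq, OfNat.ofNat_ne_zero, not_false_eq_true,
        zero_pow]
      linarith

lemma mcfRHS_sub_le {n : ℕ} {f g : EuclideanSpace ℝ (Fin n) → ℝ}
    {x y p q : EuclideanSpace ℝ (Fin n)} {α ε θ : ℝ} (hα : 0 ≤ α) (hε : 0 ≤ ε)
    (hf : ContDiffAt ℝ 2 f x) (hg : ContDiffAt ℝ 2 g y)
    (hp : ∀ ξ, fderiv ℝ f x ξ = inner ℝ p ξ) (hq : ∀ ξ, fderiv ℝ g y ξ = inner ℝ q ξ)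
    (hH : ∀ ξ η, fderiv ℝ (fderiv ℝ f) x ξ ξ - fderiv ℝ (fderiv ℝ g) y η η
      ≤ 2 * α * ‖ξ - η‖ ^ 2 + 2 * ε * ‖ξ‖ ^ 2)
    (hθ : dist (mcfFrame n p) (mcfFrame n q) ≤ θ) :
    mcfRHS n f x - mcfRHS n g y ≤ 2 * α * ((n + 1) * θ ^ 2) + 2 * ε * n := by
  rw [mcfRHS_eq_sum_mcfFrame hf hp, mcfRHS_eq_sum_mcfFrame hg hq, ← Finset.sum_sub_distrib]
  refine (Finset.sum_le_sum fun k _ => hH (mcfFrame n p k) (mcfFrame n q k)).trans ?_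
  rw [Finset.sum_add_distrib, ← Finset.mul_sum, ← Finset.mul_sum, sum_norm_sq_mcfFrame]
  have h1 : ∑ k, ‖mcfFrame n p k - mcfFrame n q k‖ ^ 2 ≤ (n + 1) * θ ^ 2 := by
    calc ∑ k, ‖mcfFrame n p k - mcfFrame n q k‖ ^ 2 ≤ ∑ _k : Option (Fin n), θ ^ 2 := by
          refine Finset.sum_le_sum fun k _ => ?_
          gcongr
          rw [← dist_eq_norm]
          exact (dist_le_pi_dist _ _ k).trans hθ
      _ = (n + 1) * θ ^ 2 := by simp
  have h2 : (0 : ℝ) ≤ ‖p‖ ^ 2 / (1 + ‖p‖ ^ 2) := by positivity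
  gcongr
  linarith

lemma IsRegularMCF.le_of_sub_le {n : ℕ} {T K C : ℝ} {u₁ u₂ : EuclideanSpace ℝ (Fin n) → ℝ → ℝ}
    (hu₁ : IsRegularMCF n T u₁) (hu₂ : IsRegularMCF n T u₂) (hC : 0 ≤ C)
    (hdiff : ∀ x y, ∀ t ∈ Ioo 0 T, u₁ x t - u₂ y t ≤ K * ‖x - y‖ + C * √t)
    (x₀ : EuclideanSpace ℝ (Fin n)) {τ : ℝ} (hτ : τ ∈ Ioo 0 T) : u₁ x₀ τ ≤ u₂ x₀ τ := by
  by_contra! hlt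
  set w := u₁ x₀ τ - u₂ x₀ τ with hw
  have hwpos : 0 < w := sub_pos.2 hlt
  have hτ0 : 0 < τ := hτ.1
  set μ := w / (4 * τ) with hμdef
  have hμ : 0 < μ := by positivity
  have hμτ : μ * τ = w / 4 := by rw [hμdef]; field_simp
  set α := 2 * (K ^ 2 + 1) / w with hαdef
  have hα : 0 < α := by positivity
  have hKL : K ^ 2 / (2 * α) < w / 2 := by
    rw [hαdef, div_lt_div_iff₀ (by positivity) (by positivity)]
    field_simp
    nlinarith [sq_nonneg K]
  set M := C * √T + K ^ 2 / (2 * α) with hM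
  set B := 2 * α * √(2 * M / α) with hB
  set θ := √(μ / (8 * α * (n + 1))) with hθdef
  have hθ : 0 < θ := by positivity
  have hθ2 : 2 * α * ((n + 1) * θ ^ 2) = μ / 4 := by
    rw [hθdef, Real.sq_sqrt (by positivity)]
    field_simp
    norm_num
  obtain ⟨δ, hδ, hunif⟩ := Metric.uniformContinuousOn_iff.1
    ((isCompact_closedBall (0 : EuclideanSpace ℝ (Fin n)) (B + 1)).uniformContinuousOn_of_continuous
      (continuous_mcfFrame n).continuousOn) θ hθ
  obtain ⟨ε, ⟨⟨⟨hε1, hε2⟩, hε3⟩, hε4⟩, hε⟩ : ∃ ε : ℝ, (((ε * ‖x₀‖ ^ 2 < w / 4 ∧ 2 * ε * n < μ / 4) ∧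
      2 * √(ε * M) < δ) ∧ 2 * √(ε * M) < 1) ∧ 0 < ε := by
    have small : ∀ (g : ℝ → ℝ) (b : ℝ), Continuous g → g 0 < b → ∀ᶠ ε in 𝓝[>] (0 : ℝ), g ε < b :=
      fun g b hg h0 => (hg.continuousAt.eventually (gt_mem_nhds h0)).filter_mono nhdsWithin_le_nhds
    exact ((((small (fun ε => ε * ‖x₀‖ ^ 2) (w / 4) (by fun_prop) (by simpa using hwpos)).and
      (small (fun ε => 2 * ε * n) (μ / 4) (by fun_prop) (by simpa using hμ))).and
      (small (fun ε => 2 * √(ε * M)) δ (by fun_prop) (by simpa using hδ))).and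
      (small (fun ε => 2 * √(ε * M)) 1 (by fun_prop) (by simp))).and self_mem_nhdsWithin |>.exists
  obtain ⟨x, y, t, ht, hxM, hxyM, hμle, hjet⟩ := exists_doubling_point hu₁ hu₂ hC hdiff hα hε hμ hτ
    hKL x₀ (by rw [hμτ]; linarith)
  have hq : ∀ η, fderiv ℝ (fun z => u₂ z t) y η = inner ℝ ((2 * α) • (x - y)) η := fun η => by
    have := (hjet 0 η).1
    simp only [map_zero, zero_sub, inner_neg_right, inner_zero_right, mul_zero, add_zero] at this
    rw [real_inner_smul_left]
    linarith
  have hp : ∀ ξ, fderiv ℝ (fun z => u₁ z t) x ξ =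
      inner ℝ ((2 * α) • (x - y) + (2 * ε) • x) ξ := fun ξ => by
    have := (hjet ξ 0).1
    simp only [map_zero, sub_zero] at this
    rw [inner_add_left, real_inner_smul_left, real_inner_smul_left]
    linarith
  have hnq : ‖(2 * α) • (x - y)‖ ≤ B := by
    rw [norm_smul, Real.norm_of_nonneg (by positivity), hB]
    gcongr
    exact Real.le_sqrt_of_sq_le (by rw [le_div_iff₀ hα]; linarith)
  have hnx : ‖(2 * ε) • x‖ ≤ 2 * √(ε * M) := by
    rw [norm_smul, Real.norm_of_nonneg (by positivity), mul_assoc]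
    gcongr
    exact Real.le_sqrt_of_sq_le (by nlinarith)
  have hnp : ‖(2 * α) • (x - y) + (2 * ε) • x‖ ≤ B + 1 :=
    (norm_add_le _ _).trans (by linarith)
  have hdist := hunif _ (by simpa using hnp) _ (by simpa using hnq.trans (by linarith : B ≤ B + 1))
    (show dist ((2 * α) • (x - y) + (2 * ε) • x) ((2 * α) • (x - y)) < δ by
      rw [dist_eq_norm, add_sub_cancel_left]; linarith)
  have := mcfRHS_sub_le hα.le hε.le (hu₁.contDiffAt_space x ht) (hu₂.contDiffAt_space y ht) hp hq
    (fun ξ η => (hjet ξ η).2) hdist.le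
  linarith

/-- Comparison principle for solutions with common Lipschitz initial data. -/
lemma IsRegularMCF.le_of_lipschitz_initial {n : ℕ} {T : ℝ}
    {u₁ u₂ : EuclideanSpace ℝ (Fin n) → ℝ → ℝ} {u₀ : EuclideanSpace ℝ (Fin n) → ℝ}
    (hu₁ : IsRegularMCF n T u₁) (hu₂ : IsRegularMCF n T u₂) (hu₀ : ∃ K : NNReal, LipschitzWith K u₀)
    (hinit₁ : TendstoLocallyUniformly (fun t x => u₁ x t) u₀ (𝓝[>] 0))
    (hinit₂ : TendstoLocallyUniformly (fun t x => u₂ x t) u₀ (𝓝[>] 0))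
    (x : EuclideanSpace ℝ (Fin n)) {t : ℝ} (ht : t ∈ Ioo 0 T) : u₁ x t ≤ u₂ x t := by
  obtain ⟨K, hK⟩ := hu₀
  have hlip : ∀ x y, |u₀ x - u₀ y| ≤ K * ‖x - y‖ := fun x y => by
    simpa [Real.dist_eq, dist_eq_norm] using hK.dist_le_mul x y
  have hneg : TendstoLocallyUniformly (fun t x => -u₂ x t) (fun x => -u₀ x) (𝓝[>] 0) := by
    rw [Metric.tendstoLocallyUniformly_iff] at hinit₂ ⊢
    simpa only [dist_neg_neg] using hinit₂
  set D := √(2 * (2 * n + 1)) with hD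
  refine hu₁.le_of_sub_le (K := K) (C := 2 * ((K + 2) * D)) hu₂ (by positivity)
    (fun x y s hs => ?_) x ht
  have h1 := hu₁.le_initial_add_sqrt K.coe_nonneg (fun x y => (abs_le.1 (hlip x y)).2) hinit₁ x hs
  have h2 := hu₂.neg.le_initial_add_sqrt (u₀ := fun x => -u₀ x) K.coe_nonneg
    (fun x y => by have := (abs_le.1 (hlip x y)).1; linarith) hneg y hs
  rw [Real.sqrt_mul (by positivity), ← hD] at h1 h2
  have h3 := (abs_le.1 (hlip x y)).2
  linarith

lemma isRegularMCF_of_contDiffOn {n : ℕ} {T : ℝ} {u : EuclideanSpace ℝ (Fin n) → ℝ → ℝ}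
    (hsmooth : ContDiffOn ℝ (⊤ : ℕ∞) (fun p : EuclideanSpace ℝ (Fin n) × ℝ => u p.1 p.2)
      (Set.univ ×ˢ Set.Ioc 0 T)) (hflow : IsMCFSolution n u (Set.Ioc 0 T)) :
    IsRegularMCF n T u := by
  refine ⟨fun x t ht => ?_, fun x t ht => hflow x t (Ioo_subset_Ioc_self ht)⟩
  refine (hsmooth.contDiffAt (prod_mem_nhds univ_mem ?_)).of_le (by norm_cast)
  exact mem_of_superset (Ioo_mem_nhds ht.1 ht.2) Ioo_subset_Ioc_self

/-- **Theorem 1.2 (Uniqueness of rotationally symmetric MCF solutions).**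
Two smooth rotationally symmetric entire-graph solutions of graphical mean
curvature flow on `ℝⁿ × (0,T]` with the same Lipschitz continuous initial data
(attained locally uniformly as `t → 0⁺`) coincide. -/
theorem mcf_uniqueness_rotationally_symmetric (n : ℕ) (T : ℝ) (hT : 0 < T)
    (u₁ u₂ : EuclideanSpace ℝ (Fin n) → ℝ → ℝ)
    (u₀ : EuclideanSpace ℝ (Fin n) → ℝ)
    (hu₀ : ∃ K : NNReal, LipschitzWith K u₀)
    (hsmooth₁ : ContDiffOn ℝ (⊤ : ℕ∞) (fun p : EuclideanSpace ℝ (Fin n) × ℝ => u₁ p.1 p.2)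
      (Set.univ ×ˢ Set.Ioc 0 T))
    (hsmooth₂ : ContDiffOn ℝ (⊤ : ℕ∞) (fun p : EuclideanSpace ℝ (Fin n) × ℝ => u₂ p.1 p.2)
      (Set.univ ×ˢ Set.Ioc 0 T))
    (hflow₁ : IsMCFSolution n u₁ (Set.Ioc 0 T))
    (hflow₂ : IsMCFSolution n u₂ (Set.Ioc 0 T))
    (hrot₁ : ∃ φ : ℝ → ℝ → ℝ, ∀ x, ∀ t ∈ Set.Ioc 0 T, u₁ x t = φ ‖x‖ t)
    (hrot₂ : ∃ φ : ℝ → ℝ → ℝ, ∀ x, ∀ t ∈ Set.Ioc 0 T, u₂ x t = φ ‖x‖ t)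
    (hinit₁ : TendstoLocallyUniformly (fun t x => u₁ x t) u₀ (nhdsWithin 0 (Set.Ioi 0)))
    (hinit₂ : TendstoLocallyUniformly (fun t x => u₂ x t) u₀ (nhdsWithin 0 (Set.Ioi 0))) :
    ∀ x, ∀ t ∈ Set.Ioc 0 T, u₁ x t = u₂ x t := by

  have hu₁ := isRegularMCF_of_contDiffOn hsmooth₁ hflow₁
  have hu₂ := isRegularMCF_of_contDiffOn hsmooth₂ hflow₂
  intro x
  have heq : EqOn (u₁ x) (u₂ x) (Ioo 0 T) := fun t ht =>
    le_antisymm (hu₁.le_of_lipschitz_initial hu₂ hu₀ hinit₁ hinit₂ x ht)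
      (hu₂.le_of_lipschitz_initial hu₁ hu₀ hinit₂ hinit₁ x ht)
  have hcont : ∀ u : EuclideanSpace ℝ (Fin n) → ℝ → ℝ,
      ContDiffOn ℝ (⊤ : ℕ∞) (fun p : EuclideanSpace ℝ (Fin n) × ℝ => u p.1 p.2)
        (Set.univ ×ˢ Set.Ioc 0 T) → ContinuousOn (u x) (Ioc 0 T) := fun u hu =>
    hu.continuousOn.comp (f := fun t => (x, t)) (by fun_prop) fun t ht => ⟨mem_univ _, ht⟩
  refine heq.of_subset_closure (hcont u₁ hsmooth₁) (hcont u₂ hsmooth₂) Ioo_subset_Ioc_self ?_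
  rw [closure_Ioo hT.ne]
  exact Ioc_subset_Icc_self
end
end

section
/- Let u : ℝⁿ × [0,T) → ℝ be continuous, smooth on ℝⁿ × (0,T), and a solution of the graphical mean curvature flow on ℝⁿ × (0,T), with u(·,0) = u₀. Fix a point X₀ ∈ ℝ^{n+1}, a number R > 1 and a constant C ∈ ℝ, and suppose u₀(x) ≥ C for every x ∈ ℝⁿ with |(x, u₀(x)) − X₀| ≤ R. Then u(x,t) ≥ C − (10/R)·t for every (x,t) ∈ ℝⁿ × (0,T) satisfying |(x, u(x,t)) − X₀|² + 2nt ≤ R²/2. -/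
open Real Filter Set

noncomputable section

/-- Second-order necessary condition for a local minimum on the line. -/
lemma IsLocalMin.second_deriv_nonneg {f f' : ℝ → ℝ} {a d : ℝ} (hmin : IsLocalMin f a)
    (hf : ∀ r, HasDerivAt f (f' r) r) (hf' : HasDerivAt f' d a) : 0 ≤ d := by
  by_contra! hd
  have hderiv : deriv f = f' := funext fun r => (hf r).deriv
  have hmax : IsLocalMax f a := by
    refine isLocalMax_of_deriv_deriv_neg ?_ hmin.deriv_eq_zero (hf a).continuousAt
    rw [hderiv, hf'.deriv]
    exact hd
  have hconst : f =ᶠ[nhds a] fun _ => f a := by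
    filter_upwards [hmin, hmax] with r h₁ h₂ using le_antisymm h₂ h₁
  have hzero : f' =ᶠ[nhds a] fun _ => 0 := by
    have := hconst.deriv
    rw [hderiv] at this
    simpa using this
  have := hzero.deriv_eq
  rw [hf'.deriv, deriv_const] at this
  exact hd.ne this

/-- A function that stays above its value at `t` just before `t` has nonpositive derivative. -/
lemma HasDerivAt.nonpos_of_eventually_left_ge {f : ℝ → ℝ} {t d : ℝ} (hf : HasDerivAt f d t)
    (h : ∀ᶠ s in nhdsWithin t (Iio t), f t ≤ f s) : d ≤ 0 := by
  have hslope := (hasDerivAt_iff_tendsto_slope.1 hf).mono_left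
    (nhdsWithin_mono t fun s (hs : s ∈ Iio t) => ne_of_lt hs)
  refine le_of_tendsto hslope ?_
  filter_upwards [h, self_mem_nhdsWithin] with s hs hst
  rw [slope_def_field]
  exact div_nonpos_of_nonneg_of_nonpos (sub_nonneg.2 hs) (sub_nonpos.2 (le_of_lt hst))

/-- The trace of a nonnegative form against the inverse metric `I - P ⊗ P / (1 + |P|²)` of a
graph with slope `P` is nonnegative. -/
lemma graph_trace_nonneg {n : ℕ}
    (Q : EuclideanSpace ℝ (Fin n) →L[ℝ] EuclideanSpace ℝ (Fin n) →L[ℝ] ℝ)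
    (hQ : ∀ v, 0 ≤ Q v v) (P : EuclideanSpace ℝ (Fin n)) :
    0 ≤ ∑ k, Q (EuclideanSpace.single k 1) (EuclideanSpace.single k 1)
      - Q P P / (1 + ‖P‖ ^ 2) := by
  have hs : 0 < √(1 + ‖P‖ ^ 2) := by positivity
  have hs2 : √(1 + ‖P‖ ^ 2) ^ 2 = 1 + ‖P‖ ^ 2 := sq_sqrt (by positivity)
  set s := √(1 + ‖P‖ ^ 2)
  set c := 1 / (s * (1 + s)) with hc
  have hP : P = ∑ k, P k • EuclideanSpace.single k (1 : ℝ) := by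
    simpa using ((EuclideanSpace.basisFun (Fin n) ℝ).sum_repr P).symm
  have hleft : ∑ k, P k * Q (EuclideanSpace.single k 1) P = Q P P := by
    refine .trans ?_ (congrArg (fun z => Q z P) hP).symm
    simp [map_sum]
  have hright : ∑ k, P k * Q P (EuclideanSpace.single k 1) = Q P P := by
    refine .trans ?_ (congrArg (Q P) hP).symm
    simp [map_sum]
  have hnorm : ∑ k, P k ^ 2 = ‖P‖ ^ 2 := by
    simp [EuclideanSpace.norm_sq_eq]
  have hsum : ∑ k, Q (EuclideanSpace.single k 1 - (c * P k) • P)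
        (EuclideanSpace.single k 1 - (c * P k) • P)
      = ∑ k, Q (EuclideanSpace.single k 1) (EuclideanSpace.single k 1)
        - c * ∑ k, P k * Q (EuclideanSpace.single k 1) P
        - c * ∑ k, P k * Q P (EuclideanSpace.single k 1)
        + c ^ 2 * Q P P * ∑ k, P k ^ 2 := by
    simp only [Finset.mul_sum, ← Finset.sum_sub_distrib, ← Finset.sum_add_distrib]
    refine Finset.sum_congr rfl fun k _ => ?_
    simp only [map_sub, map_smul, sub_apply, smul_apply,
      smul_eq_mul]
    ring
  have hcoef : 2 * c - c ^ 2 * ‖P‖ ^ 2 = 1 / (1 + ‖P‖ ^ 2) := by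
    rw [← hs2, show ‖P‖ ^ 2 = s ^ 2 - 1 by linarith, hc]
    field_simp
    ring
  have hnonneg := Finset.sum_nonneg fun k (_ : k ∈ Finset.univ) =>
    hQ (EuclideanSpace.single k 1 - (c * P k) • P)
  rw [hsum, hleft, hright, hnorm] at hnonneg
  have : Q P P / (1 + ‖P‖ ^ 2) = (2 * c - c ^ 2 * ‖P‖ ^ 2) * Q P P := by
    rw [hcoef]; ring
  rw [this]
  linarith

/-- The vector of partial derivatives. -/
def gradVec (n : ℕ) (f : EuclideanSpace ℝ (Fin n) → ℝ) (x : EuclideanSpace ℝ (Fin n)) :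
    EuclideanSpace ℝ (Fin n) :=
  WithLp.toLp 2 fun i => pd n f i x

lemma gradSq_eq_norm_sq (n : ℕ) (f : EuclideanSpace ℝ (Fin n) → ℝ)
    (x : EuclideanSpace ℝ (Fin n)) : gradSq n f x = ‖gradVec n f x‖ ^ 2 := by
  simp [gradSq, gradVec, EuclideanSpace.norm_sq_eq]

lemma fderiv_eq_inner_gradVec (n : ℕ) (f : EuclideanSpace ℝ (Fin n) → ℝ)
    (x v : EuclideanSpace ℝ (Fin n)) : fderiv ℝ f x v = inner ℝ (gradVec n f x) v := by
  conv_lhs => rw [show v = ∑ k, v k • EuclideanSpace.single k (1 : ℝ) by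
    simpa using ((EuclideanSpace.basisFun (Fin n) ℝ).sum_repr v).symm]
  simp [map_sum, PiLp.inner_apply, gradVec, pd]

lemma pd2_eq_fderiv_fderiv (n : ℕ) {f : EuclideanSpace ℝ (Fin n) → ℝ} (hf : ContDiff ℝ 2 f)
    (i j : Fin n) (x : EuclideanSpace ℝ (Fin n)) :
    pd2 n f i j x = fderiv ℝ (fderiv ℝ f) x (EuclideanSpace.single i 1)
      (EuclideanSpace.single j 1) := by
  have hdiff : DifferentiableAt ℝ (fderiv ℝ f) x :=
    (hf.fderiv_right (m := 1) (by norm_num)).differentiable (by norm_num) x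
  unfold pd2 pd
  rw [fderiv_clm_apply hdiff (differentiableAt_const _)]
  simp

lemma mcfRHS_eq (n : ℕ) {f : EuclideanSpace ℝ (Fin n) → ℝ} (hf : ContDiff ℝ 2 f)
    (x : EuclideanSpace ℝ (Fin n)) :
    mcfRHS n f x =
      ∑ k, fderiv ℝ (fderiv ℝ f) x (EuclideanSpace.single k 1) (EuclideanSpace.single k 1)
      - fderiv ℝ (fderiv ℝ f) x (gradVec n f x) (gradVec n f x)
        / (1 + ‖gradVec n f x‖ ^ 2) := by
  set B := fderiv ℝ (fderiv ℝ f) x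
  have hP : gradVec n f x = ∑ k, pd n f k x • EuclideanSpace.single k (1 : ℝ) := by
    simpa [gradVec] using ((EuclideanSpace.basisFun (Fin n) ℝ).sum_repr (gradVec n f x)).symm
  have hBP : B (gradVec n f x) (gradVec n f x) = ∑ i, ∑ j, pd n f i x * pd n f j x *
      B (EuclideanSpace.single i 1) (EuclideanSpace.single j 1) := by
    rw [hP]
    simp only [map_sum, map_smul, sum_apply, smul_apply,
      smul_eq_mul, Finset.mul_sum]
    rw [Finset.sum_comm]
    refine Finset.sum_congr rfl fun i _ => Finset.sum_congr rfl fun j _ => ?_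
    ring
  unfold mcfRHS
  simp only [pd2_eq_fderiv_fderiv n hf, gradSq_eq_norm_sq, sub_mul, Finset.sum_sub_distrib, hBP,
    Finset.sum_div]
  congr 1
  · simp [B]
  · refine Finset.sum_congr rfl fun i _ => Finset.sum_congr rfl fun j _ => ?_
    ring

/-- The second-derivative test along a line for `(ρ - |x - x₀|² - (f - h₀)²) (f - C)`. -/
lemma second_variation_nonneg {E : Type*} [NormedAddCommGroup E] [InnerProductSpace ℝ E]
    {f : E → ℝ} (hf : ContDiff ℝ 2 f) (x₀ x : E) (h₀ ρ C : ℝ)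
    (hmin : IsLocalMin (fun y => (ρ - ‖y - x₀‖ ^ 2 - (f y - h₀) ^ 2) * (f y - C)) x) (v : E) :
    0 ≤ (-(2 * ‖v‖ ^ 2) - 2 * fderiv ℝ f x v ^ 2
          - 2 * (f x - h₀) * fderiv ℝ (fderiv ℝ f) x v v) * (f x - C)
      + 2 * (-(2 * inner ℝ (x - x₀) v) - 2 * (f x - h₀) * fderiv ℝ f x v) * fderiv ℝ f x v
      + (ρ - ‖x - x₀‖ ^ 2 - (f x - h₀) ^ 2) * fderiv ℝ (fderiv ℝ f) x v v := by
  have hd1 : ∀ z, HasFDerivAt f (fderiv ℝ f z) z := fun z =>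
    (hf.differentiable (by norm_num) z).hasFDerivAt
  have hd2 : HasFDerivAt (fderiv ℝ f) (fderiv ℝ (fderiv ℝ f) x) x :=
    ((hf.fderiv_right (m := 1) (by norm_num)).differentiable (by norm_num) x).hasFDerivAt
  have hline : ∀ r : ℝ, HasDerivAt (fun r : ℝ => x + r • v) v r := by
    intro r
    simpa using ((hasDerivAt_id r).smul_const v).const_add x
  have hφ : ∀ r : ℝ, HasDerivAt (fun r : ℝ => f (x + r • v)) (fderiv ℝ f (x + r • v) v) r :=
    fun r => (hd1 _).comp_hasDerivAt r (hline r)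
  have hφ' : HasDerivAt (fun r : ℝ => fderiv ℝ f (x + r • v) v)
      (fderiv ℝ (fderiv ℝ f) x v v) 0 := by
    have hd2' : HasFDerivAt (fderiv ℝ f) (fderiv ℝ (fderiv ℝ f) x) (x + (0 : ℝ) • v) := by
      simpa using hd2
    have hcomp : HasDerivAt (fun r : ℝ => fderiv ℝ f (x + r • v))
        (fderiv ℝ (fderiv ℝ f) x v) 0 := hd2'.comp_hasDerivAt (0 : ℝ) (hline 0)
    refine (hcomp.clm_apply (hasDerivAt_const (0 : ℝ) v)).congr_deriv ?_
    rw [map_zero, add_zero]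
  have hN : ∀ r : ℝ, ‖x + r • v - x₀‖ ^ 2
      = ‖x - x₀‖ ^ 2 + 2 * inner ℝ (x - x₀) v * r + ‖v‖ ^ 2 * r ^ 2 := by
    intro r
    rw [show x + r • v - x₀ = x - x₀ + r • v by abel, norm_add_sq_real, inner_smul_right,
      norm_smul, mul_pow, norm_eq_abs, sq_abs]
    ring
  have hη1 : ∀ r : ℝ, HasDerivAt
      (fun r : ℝ => ρ - ‖x + r • v - x₀‖ ^ 2 - (f (x + r • v) - h₀) ^ 2)
      (-(2 * inner ℝ (x - x₀) v) - 2 * ‖v‖ ^ 2 * r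
        - 2 * (f (x + r • v) - h₀) * fderiv ℝ f (x + r • v) v) r := by
    intro r
    simp only [hN]
    have h1 := ((((hasDerivAt_id r).const_mul (2 * inner ℝ (x - x₀) v)).const_add
      (‖x - x₀‖ ^ 2)).add (((hasDerivAt_id r).pow 2).const_mul (‖v‖ ^ 2))).const_sub ρ
    refine (h1.sub (((hφ r).sub_const h₀).pow 2)).congr_deriv ?_
    simp
    ring
  have hη2 : HasDerivAt (fun r : ℝ => -(2 * inner ℝ (x - x₀) v) - 2 * ‖v‖ ^ 2 * r
        - 2 * (f (x + r • v) - h₀) * fderiv ℝ f (x + r • v) v)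
      (-(2 * ‖v‖ ^ 2) - 2 * fderiv ℝ f x v ^ 2
        - 2 * (f x - h₀) * fderiv ℝ (fderiv ℝ f) x v v) 0 := by
    have h1 := ((hasDerivAt_id (0 : ℝ)).const_mul (2 * ‖v‖ ^ 2)).const_sub
      (-(2 * inner ℝ (x - x₀) v))
    refine (h1.sub ((((hφ 0).sub_const h₀).const_mul 2).mul hφ')).congr_deriv ?_
    simp
    ring
  have hψ : ∀ r : ℝ, HasDerivAt _ _ r := fun r => (hη1 r).mul ((hφ r).sub_const C)
  have hψ' := (hη2.mul ((hφ 0).sub_const C)).add ((hη1 0).mul hφ')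
  have hmin0 : IsLocalMin (fun r : ℝ => (ρ - ‖x + r • v - x₀‖ ^ 2
      - (f (x + r • v) - h₀) ^ 2) * (f (x + r • v) - C)) 0 := by
    have hc : Tendsto (fun r : ℝ => x + r • v) (nhds 0) (nhds x) := by
      simpa using (hline 0).continuousAt.tendsto
    have := hc.eventually hmin
    filter_upwards [this] with r hr
    simpa using hr
  have key := hmin0.second_deriv_nonneg hψ hψ'
  simp only [zero_smul, add_zero, mul_zero, sub_zero] at key
  linarith

/-- At a spatial local minimum of `(ρ - |x - x₀|² - (f - h₀)²) (f - C)`, the Hessian test, traced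
with the inverse metric of the graph of `f`. -/
lemma graph_trace_nonneg_of_isLocalMin (n : ℕ) {f : EuclideanSpace ℝ (Fin n) → ℝ}
    (hf : ContDiff ℝ 2 f) (x₀ x : EuclideanSpace ℝ (Fin n)) (h₀ ρ C : ℝ)
    (hmin : IsLocalMin (fun y => (ρ - ‖y - x₀‖ ^ 2 - (f y - h₀) ^ 2) * (f y - C)) x) :
    0 ≤ (-2 * n - 2 * (f x - h₀) * mcfRHS n f x) * (f x - C)
      + (ρ - ‖x - x₀‖ ^ 2 - (f x - h₀) ^ 2) * mcfRHS n f x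
      - 4 * (inner ℝ (x - x₀) (gradVec n f x) + (f x - h₀) * ‖gradVec n f x‖ ^ 2)
        / (1 + ‖gradVec n f x‖ ^ 2) := by
  set P := gradVec n f x with hPdef
  set y := x - x₀ with hy
  set V := f x - h₀ with hV
  set w := f x - C with hw
  set η := ρ - ‖y‖ ^ 2 - V ^ 2 with hη
  set B := fderiv ℝ (fderiv ℝ f) x with hB
  let I : EuclideanSpace ℝ (Fin n) →L[ℝ] EuclideanSpace ℝ (Fin n) →L[ℝ] ℝ := innerSL ℝ
  let Q : EuclideanSpace ℝ (Fin n) →L[ℝ] EuclideanSpace ℝ (Fin n) →L[ℝ] ℝ :=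
    (-2 * w) • I + (-2 * w - 4 * V) • (innerSL ℝ P).smulRight (innerSL ℝ P)
      + (η - 2 * w * V) • B - (4 : ℝ) • (innerSL ℝ y).smulRight (innerSL ℝ P)
  have hQapp : ∀ v v', Q v v' = (-2 * w) * inner ℝ v v'
      + (-2 * w - 4 * V) * (inner ℝ P v * inner ℝ P v') + (η - 2 * w * V) * B v v'
      - 4 * (inner ℝ y v * inner ℝ P v') := by
    intro v v'
    have hI : I v v' = inner ℝ v v' := innerSL_apply_apply ℝ v v'
    simp [Q, hI]
  have hQ : ∀ v, 0 ≤ Q v v := by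
    intro v
    have key := second_variation_nonneg hf x₀ x h₀ ρ C hmin v
    simp only [fderiv_eq_inner_gradVec, ← hPdef, ← hy, ← hV, ← hw, ← hη, ← hB] at key
    rw [hQapp, real_inner_self_eq_norm_sq]
    linarith
  have htrace := graph_trace_nonneg Q hQ P
  have hsum : ∑ k, Q (EuclideanSpace.single k 1) (EuclideanSpace.single k 1)
      = (-2 * w) * n + (-2 * w - 4 * V) * ‖P‖ ^ 2
        + (η - 2 * w * V) * ∑ k, B (EuclideanSpace.single k 1) (EuclideanSpace.single k 1)
        - 4 * inner ℝ y P := by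
    simp only [hQapp, Finset.sum_add_distrib, Finset.sum_sub_distrib, ← Finset.mul_sum]
    congr 2
    · congr 2
      · simp
      · simp [EuclideanSpace.real_norm_sq_eq, EuclideanSpace.inner_single_right, ← pow_two]
    · simp [PiLp.inner_apply, mul_comm]
  rw [hsum, hQapp, real_inner_self_eq_norm_sq] at htrace
  rw [mcfRHS_eq n hf x, ← hPdef, ← hB]
  refine htrace.trans_eq ?_
  have : (1 + ‖P‖ ^ 2) ≠ 0 := by positivity
  field_simp
  ring

/-- On a graph of slope `P`, the tangential component of a position vector `(y, V)` of length at
most `R` pairs with the gradient of the height function to at least `-R`. -/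
lemma graph_inner_lower_bound {E : Type*} [NormedAddCommGroup E] [InnerProductSpace ℝ E]
    (y P : E) {V R : ℝ} (hR : 0 ≤ R) (h : ‖y‖ ^ 2 + V ^ 2 ≤ R ^ 2) :
    -(R * (1 + ‖P‖ ^ 2)) ≤ inner ℝ y P + V * ‖P‖ ^ 2 := by
  have h1 : -(‖y‖ * ‖P‖) ≤ inner ℝ y P := (abs_le.1 (abs_real_inner_le_norm y P)).1
  have h2 : -|V| * ‖P‖ ^ 2 ≤ V * ‖P‖ ^ 2 := by gcongr; exact neg_abs_le V
  have h3 : (‖P‖ * (‖y‖ + |V| * ‖P‖)) ^ 2 ≤ (R * (1 + ‖P‖ ^ 2)) ^ 2 := by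
    have hcs : (‖y‖ + |V| * ‖P‖) ^ 2 ≤ R ^ 2 * (1 + ‖P‖ ^ 2) := by
      have : (‖y‖ ^ 2 + V ^ 2) * (1 + ‖P‖ ^ 2) ≤ R ^ 2 * (1 + ‖P‖ ^ 2) := by gcongr
      nlinarith [sq_nonneg (‖y‖ * ‖P‖ - |V|), sq_abs V]
    calc (‖P‖ * (‖y‖ + |V| * ‖P‖)) ^ 2 = ‖P‖ ^ 2 * (‖y‖ + |V| * ‖P‖) ^ 2 := by ring
      _ ≤ (1 + ‖P‖ ^ 2) * (R ^ 2 * (1 + ‖P‖ ^ 2)) := by gcongr; linarith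
      _ = (R * (1 + ‖P‖ ^ 2)) ^ 2 := by ring
  have h4 := le_of_sq_le_sq h3 (by positivity)
  linarith

/-- **Lemma 4.1 (local lower bound).** If `u₀ ≥ C` on the part of the initial
graph inside the ball `|𝐱 − X₀| ≤ R` (with `X₀ = (x₀, h₀) ∈ ℝⁿ⁺¹`, `R > 1`),
then `u(x,t) ≥ C − (10/R) t` on the parabolic ball
`|𝐱 − X₀|² + 2nt ≤ R²/2`, `𝐱 = (x, u(x,t))`. -/
theorem mcf_local_lower_bound (n : ℕ) (T : ℝ) (hT : 0 < T)
    (u : EuclideanSpace ℝ (Fin n) → ℝ → ℝ) (u₀ : EuclideanSpace ℝ (Fin n) → ℝ)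
    (hcont : ContinuousOn (fun p : EuclideanSpace ℝ (Fin n) × ℝ => u p.1 p.2)
      (Set.univ ×ˢ Set.Ico 0 T))
    (hsmooth : ContDiffOn ℝ (⊤ : ℕ∞) (fun p : EuclideanSpace ℝ (Fin n) × ℝ => u p.1 p.2)
      (Set.univ ×ˢ Set.Ioo 0 T))
    (hflow : IsMCFSolution n u (Set.Ioo 0 T))
    (hinit : ∀ x, u x 0 = u₀ x)
    (x₀ : EuclideanSpace ℝ (Fin n)) (h₀ : ℝ)   -- the point `X₀ = (x₀, h₀) ∈ ℝⁿ⁺¹`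
    (R : ℝ) (hR : 1 < R) (C : ℝ)
    (hlower : ∀ x, ‖x - x₀‖ ^ 2 + (u₀ x - h₀) ^ 2 ≤ R ^ 2 → C ≤ u₀ x) :
    ∀ x, ∀ t ∈ Set.Ioo 0 T,
      ‖x - x₀‖ ^ 2 + (u x t - h₀) ^ 2 + 2 * n * t ≤ R ^ 2 / 2 →
      C - (10 / R) * t ≤ u x t := by
  intro x₁ t₁ ht₁ hball
  have hR0 : 0 < R := one_pos.trans hR
  let η : EuclideanSpace ℝ (Fin n) × ℝ → ℝ := fun p =>
    R ^ 2 - ‖p.1 - x₀‖ ^ 2 - (u p.1 p.2 - h₀) ^ 2 - 2 * n * p.2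
  let h : EuclideanSpace ℝ (Fin n) × ℝ → ℝ := fun p => η p * (u p.1 p.2 - C) + 5 * R * p.2
  let S : Set (EuclideanSpace ℝ (Fin n) × ℝ) := Metric.closedBall x₀ R ×ˢ Icc 0 t₁
  let K : Set (EuclideanSpace ℝ (Fin n) × ℝ) := S ∩ η ⁻¹' Ici 0
  have hcontS : ContinuousOn (fun p : EuclideanSpace ℝ (Fin n) × ℝ => u p.1 p.2) S :=
    hcont.mono fun p hp => ⟨mem_univ _, hp.2.1, hp.2.2.trans_lt ht₁.2⟩
  have hηS : ContinuousOn η S := by fun_prop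
  have hK : IsCompact K := by
    have hS : IsCompact S := (isCompact_closedBall x₀ R).prod isCompact_Icc
    exact hS.of_isClosed_subset (hηS.preimage_isClosed_of_isClosed hS.isClosed isClosed_Ici)
      inter_subset_left
  have hhK : ContinuousOn h K := by
    have : ContinuousOn h S := by fun_prop
    exact this.mono inter_subset_left
  have mem_K : ∀ {x t}, 0 ≤ t → t ≤ t₁ → 0 ≤ η (x, t) → (x, t) ∈ K := by
    intro x t ht0 ht1 hη
    refine ⟨⟨?_, ht0, ht1⟩, hη⟩
    rw [mem_closedBall_iff_norm]
    have hnt : 0 ≤ 2 * (n : ℝ) * t := by positivity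
    refine le_of_sq_le_sq ?_ hR0.le
    simp only [η] at hη
    nlinarith [sq_nonneg (u x t - h₀)]
  have hη₁ : R ^ 2 / 2 ≤ η (x₁, t₁) := by simp only [η]; linarith
  have hmem₁ : (x₁, t₁) ∈ K := mem_K ht₁.1.le le_rfl (by nlinarith)
  suffices hpos : 0 ≤ h (x₁, t₁) by
    by_contra! hlt
    have h1 : η (x₁, t₁) * (u x₁ t₁ - C) < η (x₁, t₁) * (-(10 / R) * t₁) :=
      mul_lt_mul_of_pos_left (by linarith) (by nlinarith)
    have h2 : R ^ 2 / 2 * (10 / R * t₁) ≤ η (x₁, t₁) * (10 / R * t₁) := by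
      have := ht₁.1
      gcongr
    have h3 : R ^ 2 / 2 * (10 / R * t₁) = 5 * R * t₁ := by field_simp; ring
    simp only [h] at hpos
    linarith
  obtain ⟨⟨x, t⟩, hxt, hmin⟩ := hK.exists_isMinOn ⟨_, hmem₁⟩ hhK
  refine le_trans ?_ (hmin hmem₁)
  by_contra! hneg
  obtain ⟨⟨-, ht0, ht1⟩, hη0⟩ := hxt
  simp only at ht0 ht1
  replace hη0 : 0 ≤ η (x, t) := hη0
  have hηpos : 0 < η (x, t) := by
    refine hη0.lt_of_ne fun h0 => hneg.not_ge ?_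
    simp only [h, ← h0, zero_mul, zero_add]
    positivity
  have htpos : 0 < t := by
    refine ht0.lt_of_ne fun h0 => hneg.not_ge ?_
    subst h0
    have hC : C ≤ u x 0 := by
      rw [hinit]
      apply hlower
      simp only [η, hinit] at hη0
      linarith
    have := mul_nonneg hη0 (sub_nonneg.2 hC)
    simpa [h] using this
  have htT : t ∈ Ioo 0 T := ⟨htpos, ht1.trans_lt ht₁.2⟩
  have hopen : IsOpen ((univ : Set (EuclideanSpace ℝ (Fin n))) ×ˢ Ioo 0 T) :=
    isOpen_univ.prod isOpen_Ioo
  have hsmoothAt : ∀ z, ContDiffAt ℝ 2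
      (fun p : EuclideanSpace ℝ (Fin n) × ℝ => u p.1 p.2) (z, t) := fun z =>
    (hsmooth.contDiffAt (hopen.mem_nhds ⟨mem_univ _, htT⟩)).of_le
      (WithTop.coe_le_coe.2 (le_top : (2 : ℕ∞) ≤ ⊤))
  have hspace : ContDiff ℝ 2 fun z => u z t := contDiff_iff_contDiffAt.2 fun z =>
    (hsmoothAt z).comp z (f := fun z => (z, t)) (by fun_prop)
  have htime : HasDerivAt (fun s => u x s) (mcfRHS n (fun z => u z t) x) t := by
    rw [← hflow x t htT]
    have : ContDiffAt ℝ 2 (fun s => u x s) t :=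
      (hsmoothAt x).comp t (f := fun s => (x, s)) (by fun_prop)
    exact (this.differentiableAt (by simp)).hasDerivAt
  set m := mcfRHS n (fun z => u z t) x with hm
  have hηspace : Continuous fun z => η (z, t) := by
    have := hspace.continuous
    simp only [η]
    fun_prop
  have hηtime : ContinuousAt (fun s => η (x, s)) t := by
    have := htime.continuousAt
    simp only [η]
    fun_prop
  have hspaceMin : IsLocalMin (fun z => (R ^ 2 - 2 * n * t - ‖z - x₀‖ ^ 2 - (u z t - h₀) ^ 2)
      * (u z t - C)) x := by
    filter_upwards [hηspace.continuousAt.eventually (lt_mem_nhds hηpos)] with z hz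
    have := hmin (mem_K ht0 ht1 hz.le)
    simp only [h, η, mem_ofPred_eq] at this
    linarith
  have hS := graph_trace_nonneg_of_isLocalMin n hspace x₀ x h₀ (R ^ 2 - 2 * n * t) C hspaceMin
  rw [← hm] at hS
  have hηderiv : HasDerivAt (fun s => η (x, s)) (-2 * (u x t - h₀) * m - 2 * n) t := by
    refine ((((htime.sub_const h₀).pow 2).const_sub (R ^ 2 - ‖x - x₀‖ ^ 2)).sub
      ((hasDerivAt_id t).const_mul (2 * (n : ℝ)))).congr_deriv ?_
    simp
  have hhderiv : HasDerivAt (fun s => h (x, s))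
      ((-2 * (u x t - h₀) * m - 2 * n) * (u x t - C) + η (x, t) * m + 5 * R) t := by
    refine ((hηderiv.mul (htime.sub_const C)).add
      ((hasDerivAt_id t).const_mul (5 * R))).congr_deriv ?_
    simp
  have hT' := hhderiv.nonpos_of_eventually_left_ge <| by
    filter_upwards [nhdsWithin_le_nhds (hηtime.eventually (lt_mem_nhds hηpos)),
      nhdsWithin_le_nhds (lt_mem_nhds htpos), self_mem_nhdsWithin] with s hs hs0 hst
    exact hmin (mem_K hs0.le ((le_of_lt hst).trans ht1) hs.le)
  set P := gradVec n (fun z => u z t) x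
  have hbound : ‖x - x₀‖ ^ 2 + (u x t - h₀) ^ 2 ≤ R ^ 2 := by
    have hnt : 0 ≤ 2 * (n : ℝ) * t := by positivity
    simp only [η] at hη0
    linarith
  have htangent := graph_inner_lower_bound (x - x₀) P hR0.le hbound
  have hquot : -R ≤ (inner ℝ (x - x₀) P + (u x t - h₀) * ‖P‖ ^ 2) / (1 + ‖P‖ ^ 2) := by
    rw [le_div_iff₀ (by positivity)]
    linarith
  rw [mul_div_assoc] at hS
  simp only [η] at hT'
  linarith
end
end
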